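/- arXiv:2110.06008 — 5 statements merged into one kernel-verified Lean document; each statement's English description precedes it below -/
import Mathlib

section
/- For every α ≥ 1 and every y ≥ √3/2: g_α(y) ≤ g_α(√3/2). That is, max_{y ≥ √3/2} g_α(y) = g_α(√3/2). -/
/-- First coordinate of the circumcenter shift on the line `x = 1/2`. -/
noncomputable def a1 (y : ℝ) : ℝ := 1 / 4 + 1 / (16 * y ^ 2)

/-- Second coordinate of the circumcenter shift on the line `x = 1/2`. -/
noncomputable def a2 (y : ℝ) : ℝ := 1 / 2 - 1 / (8 * y ^ 2)

/-- `g_α(y) = θ̂_{1/2,y}(a(y);α)`, the charged theta function on the line `x = 1/2`. -/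
noncomputable def gTheta (α y : ℝ) : ℝ :=
  ∑' p : ℤ × ℤ,
    Real.exp (-(Real.pi * α / y) *
      ((p.1 : ℝ) ^ 2 + (p.1 : ℝ) * (p.2 : ℝ) + (1 / 4 + y ^ 2) * (p.2 : ℝ) ^ 2)) *
    Real.cos (2 * Real.pi * ((p.1 : ℝ) * a2 y - (p.2 : ℝ) * a1 y))

open Real

/-- The general term of `gTheta`, with `X = π α`. -/
noncomputable def chargedTerm (X y : ℝ) (p : ℤ × ℤ) : ℝ :=
  exp (-(X / y) * ((p.1 : ℝ) ^ 2 + (p.1 : ℝ) * (p.2 : ℝ) + (1 / 4 + y ^ 2) * (p.2 : ℝ) ^ 2)) *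
    cos (2 * π * ((p.1 : ℝ) * a2 y - (p.2 : ℝ) * a1 y))

/-- The norm form of the hexagonal lattice at the point `(n.1 + 1, n.2)` of the open sector. -/
def hexNorm (n : ℕ × ℕ) : ℕ := (n.1 + 1) ^ 2 + (n.1 + 1) * n.2 + n.2 ^ 2

/-- The sum of `f` over the orbit of `(n.1 + 1, n.2)` under rotation by `2π/3`. -/
def orbitSum (f : ℤ × ℤ → ℝ) (n : ℕ × ℕ) : ℝ :=
  f ((n.1 : ℤ) + 1, (n.2 : ℤ)) + f ((n.2 : ℤ), -((n.1 : ℤ) + 1 + n.2)) +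
    f (-((n.1 : ℤ) + 1 + n.2), (n.1 : ℤ) + 1)

/-- The six rotations of the sector by multiples of `π/3`. -/
def sectorMap (q : Fin 6 × (ℕ × ℕ)) : ℤ × ℤ :=
  let k : ℤ := (q.2.1 : ℤ) + 1
  let l : ℤ := (q.2.2 : ℤ)
  match q.1 with
  | 0 => (k, l)
  | 1 => (l, -(k + l))
  | 2 => (-(k + l), k)
  | 3 => (-k, -l)
  | 4 => (-l, k + l)
  | 5 => (k + l, -k)

lemma sectorMap_injective : Function.Injective sectorMap := by
  rintro ⟨i, a, b⟩ ⟨j, c, d⟩ h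
  fin_cases i <;> fin_cases j <;> simp [sectorMap] at h ⊢ <;> omega

lemma exists_sectorMap_eq {p : ℤ × ℤ} (hp : p ≠ 0) : ∃ q, sectorMap q = p := by
  obtain ⟨k, l⟩ := p
  have h0 : ¬ (k = 0 ∧ l = 0) := fun h => hp (by simp [h.1, h.2])
  by_cases h1 : 0 < k ∧ 0 ≤ l
  · exact ⟨(0, (k - 1).toNat, l.toNat), by simp [sectorMap]; omega⟩
  by_cases h2 : 0 ≤ k ∧ k + l < 0
  · exact ⟨(1, (-l - k - 1).toNat, k.toNat), by simp [sectorMap]; omega⟩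
  by_cases h3 : 0 < l ∧ k + l ≤ 0
  · exact ⟨(2, (l - 1).toNat, (-k - l).toNat), by simp [sectorMap]; omega⟩
  by_cases h4 : k < 0 ∧ l ≤ 0
  · exact ⟨(3, (-k - 1).toNat, (-l).toNat), by simp [sectorMap]; omega⟩
  by_cases h5 : k ≤ 0 ∧ 0 < k + l
  · exact ⟨(4, (k + l - 1).toNat, (-k).toNat), by simp [sectorMap]; omega⟩
  · exact ⟨(5, (-l - 1).toNat, (k + l).toNat), by simp [sectorMap]; omega⟩

lemma hasSum_orbitSum {f : ℤ × ℤ → ℝ} (hf : Summable f) (heven : ∀ p, f (-p) = f p) :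
    Summable (orbitSum f) ∧ ∑' p, f p = f 0 + 2 * ∑' n, orbitSum f n := by
  have hs : Summable fun q => f (sectorMap q) := hf.comp_injective sectorMap_injective
  have hi : ∀ i : Fin 6, Summable fun n => f (sectorMap (i, n)) := hs.prod_factor
  have e3 : ∀ n, f (sectorMap (3, n)) = f (sectorMap (0, n)) := fun n => by
    rw [← heven]; simp [sectorMap]
  have e4 : ∀ n, f (sectorMap (4, n)) = f (sectorMap (1, n)) := fun n => by
    rw [← heven]; simp [sectorMap]
  have e5 : ∀ n, f (sectorMap (5, n)) = f (sectorMap (2, n)) := fun n => by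
    rw [← heven]; simp [sectorMap]
  have ho : orbitSum f = fun n => f (sectorMap (0, n)) + f (sectorMap (1, n)) +
      f (sectorMap (2, n)) := rfl
  refine ⟨ho ▸ ((hi 0).add (hi 1)).add (hi 2), ?_⟩
  rw [hf.tsum_eq_add_tsum_ite 0]
  congr 1
  have hsupp : Function.support (fun p : ℤ × ℤ => if p = 0 then (0 : ℝ) else f p) ⊆
      Set.range sectorMap := by
    intro p hp
    by_cases h : p = 0
    · simp [h] at hp
    · exact exists_sectorMap_eq h
  rw [← sectorMap_injective.tsum_eq hsupp]
  have hne : ∀ q, sectorMap q ≠ 0 := by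
    rintro ⟨i, a, b⟩ h
    fin_cases i <;> simp [sectorMap] at h <;> omega
  simp only [hne, if_false]
  rw [hs.tsum_prod' hi, tsum_fintype, ho]
  simp only [Fin.sum_univ_six, e3, e4, e5]
  rw [((hi 0).add (hi 1)).tsum_add (hi 2), (hi 0).tsum_add (hi 1)]
  ring

lemma three_le_hexNorm {n : ℕ × ℕ} (hn : n ≠ 0) : 3 ≤ hexNorm n := by
  obtain ⟨a, b⟩ := n
  have : a ≠ 0 ∨ b ≠ 0 := by
    by_contra! h
    exact hn (by simp [h.1, h.2])
  simp only [hexNorm]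
  rcases this with h | h
  · have : 1 ≤ a := Nat.one_le_iff_ne_zero.2 h
    nlinarith [Nat.zero_le (a * b), Nat.zero_le b]
  · have : 1 ≤ b := Nat.one_le_iff_ne_zero.2 h
    nlinarith [Nat.zero_le (a * b), Nat.zero_le a]

lemma le_hexNorm (n : ℕ × ℕ) : 1 + 3 * n.1 + 2 * n.2 ≤ hexNorm n := by
  obtain ⟨a, b⟩ := n
  simp only [hexNorm]
  have ha : a ≤ a ^ 2 := Nat.le_self_pow two_ne_zero a
  have hb : b ≤ b ^ 2 := Nat.le_self_pow two_ne_zero b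
  nlinarith [Nat.zero_le (a * b)]

lemma hasSum_geometric_prod {z : ℝ} (h0 : 0 ≤ z) (h1 : z < 1) :
    HasSum (fun n : ℕ × ℕ => z ^ (1 + 3 * n.1 + 2 * n.2)) (z / ((1 - z ^ 2) * (1 - z ^ 3))) := by
  have h3 := hasSum_geometric_of_lt_one (pow_nonneg h0 3) (pow_lt_one₀ h0 h1 three_ne_zero)
  have h2 := hasSum_geometric_of_lt_one (pow_nonneg h0 2) (pow_lt_one₀ h0 h1 two_ne_zero)
  have h := (h3.mul h2 (h3.summable.mul_of_nonneg h2.summable (fun n => by positivity)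
    (fun n => by positivity))).mul_left z
  have e : z / ((1 - z ^ 2) * (1 - z ^ 3)) = z * ((1 - z ^ 3)⁻¹ * (1 - z ^ 2)⁻¹) := by
    rw [div_eq_mul_inv, mul_inv]; ring
  rw [e]
  refine h.congr_fun fun n => ?_
  rw [pow_add, pow_add, pow_mul, pow_mul]; ring

/-- Comparison of a sum over the sector, away from its vertex, with a geometric series. -/
lemma tsum_le_of_le_mul_pow_hexNorm {a : ℕ × ℕ → ℝ} {C z : ℝ} (ha : Summable a) (hC : 0 ≤ C)
    (h0 : 0 ≤ z) (h1 : z < 1) (h : ∀ n, n ≠ 0 → a n ≤ C * z ^ hexNorm n) :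
    ∑' n, a n ≤ a 0 + C * (z / ((1 - z ^ 2) * (1 - z ^ 3)) - z) := by
  have hg := (hasSum_geometric_prod h0 h1).mul_left C
  have hd := ha.hasSum.sub hg
  have key : ∑' n, a n - C * (z / ((1 - z ^ 2) * (1 - z ^ 3))) ≤ a 0 - C * z := by
    refine hasSum_le (f := fun n => a n - C * z ^ (1 + 3 * n.1 + 2 * n.2))
      (g := fun n : ℕ × ℕ => if n = 0 then a 0 - C * z else 0) (fun n => ?_) hd
      (hasSum_ite_eq (0 : ℕ × ℕ) (a 0 - C * z))
    by_cases hn : n = 0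
    · simp [hn]
    · simp only [hn, if_false, sub_nonpos]
      exact (h n hn).trans (mul_le_mul_of_nonneg_left
        (pow_le_pow_of_le_one h0 h1.le (le_hexNorm n)) hC)
  linarith

lemma natAbs_le_sq (k : ℤ) : (k.natAbs : ℝ) ≤ (k : ℝ) ^ 2 := by
  have : (k.natAbs : ℤ) ≤ k ^ 2 := by
    rw [← Int.natAbs_sq]; exact_mod_cast Nat.le_self_pow two_ne_zero _
  rw [Nat.cast_natAbs]
  rw [Int.natCast_natAbs] at this
  exact_mod_cast this

lemma summable_pow_natAbs {z : ℝ} (h0 : 0 ≤ z) (h1 : z < 1) :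
    Summable fun k : ℤ => z ^ k.natAbs := by
  refine Summable.of_nat_of_neg ?_ ?_ <;> simpa using summable_geometric_of_lt_one h0 h1

lemma chargedTerm_neg (X y : ℝ) (p : ℤ × ℤ) : chargedTerm X y (-p) = chargedTerm X y p := by
  simp only [chargedTerm, Prod.fst_neg, Prod.snd_neg, Int.cast_neg]
  rw [← cos_neg]
  congr 2 <;> ring

lemma chargedTerm_zero (X y : ℝ) : chargedTerm X y 0 = 1 := by simp [chargedTerm]

/-- `|chargedTerm X y p|` is at most a power of `exp (-X/y)`. -/
lemma abs_chargedTerm_le {X y : ℝ} (hX : 0 < X) (hy : 0 < y) (hy2 : 3 / 4 ≤ y ^ 2) (p : ℤ × ℤ) :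
    |chargedTerm X y p| ≤
      exp (-(X / y) * ((p.1 : ℝ) ^ 2 + (p.1 : ℝ) * (p.2 : ℝ) + (p.2 : ℝ) ^ 2)) := by
  rw [chargedTerm, abs_mul, abs_exp]
  refine (mul_le_of_le_one_right (exp_pos _).le (abs_cos_le_one _)).trans ?_
  have : 0 < X / y := by positivity
  apply exp_le_exp.2
  nlinarith [mul_nonneg (mul_nonneg this.le (sub_nonneg.2 hy2)) (sq_nonneg (p.2 : ℝ))]

lemma summable_chargedTerm {X y : ℝ} (hX : 0 < X) (hy : 0 < y) (hy2 : 3 / 4 ≤ y ^ 2) :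
    Summable (chargedTerm X y) := by
  have ht : 0 < X / y := by positivity
  set z := exp (-(X / y) / 2) with hz
  have hz1 : z < 1 := by rw [hz, exp_lt_one_iff]; linarith
  have hs := summable_pow_natAbs (exp_pos _).le hz1
  refine Summable.of_norm_bounded (hs.mul_of_nonneg hs (fun _ => by positivity)
    (fun _ => by positivity)) (fun p => (abs_chargedTerm_le hX hy hy2 p).trans ?_)
  rw [← pow_add, ← exp_nat_mul]
  apply exp_le_exp.2
  push_cast
  nlinarith [mul_le_mul_of_nonneg_left (natAbs_le_sq p.1) ht.le,
    mul_le_mul_of_nonneg_left (natAbs_le_sq p.2) ht.le,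
    mul_nonneg ht.le (sq_nonneg ((p.1 : ℝ) + p.2))]

lemma gTheta_eq_orbitSum {α y : ℝ} (hα : 0 < α) (hy : 0 < y) (hy2 : 3 / 4 ≤ y ^ 2) :
    Summable (orbitSum (chargedTerm (π * α) y)) ∧
      gTheta α y = 1 + 2 * ∑' n, orbitSum (chargedTerm (π * α) y) n := by
  have h := hasSum_orbitSum (summable_chargedTerm (mul_pos pi_pos hα) hy hy2)
    (chargedTerm_neg (π * α) y)
  exact ⟨h.1, by rw [← chargedTerm_zero (π * α) y]; exact h.2⟩

lemma abs_orbitSum_le {X y : ℝ} (hX : 0 < X) (hy : 0 < y) (hy2 : 3 / 4 ≤ y ^ 2) (n : ℕ × ℕ) :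
    |orbitSum (chargedTerm X y) n| ≤ 3 * exp (-(X / y)) ^ hexNorm n := by
  have h : ∀ k l : ℤ, (k : ℝ) ^ 2 + k * l + (l : ℝ) ^ 2 = hexNorm n →
      |chargedTerm X y (k, l)| ≤ exp (-(X / y)) ^ hexNorm n := fun k l hkl => by
    rw [← exp_nat_mul, ← hkl, mul_comm]
    exact abs_chargedTerm_le hX hy hy2 (k, l)
  have h1 := h ((n.1 : ℤ) + 1) n.2 (by simp [hexNorm])
  have h2 := h (n.2 : ℤ) (-((n.1 : ℤ) + 1 + n.2)) (by simp [hexNorm]; ring)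
  have h3 := h (-((n.1 : ℤ) + 1 + n.2)) ((n.1 : ℤ) + 1) (by simp [hexNorm]; ring)
  rw [orbitSum]
  linarith [abs_add_three (chargedTerm X y ((n.1 : ℤ) + 1, (n.2 : ℤ)))
    (chargedTerm X y ((n.2 : ℤ), -((n.1 : ℤ) + 1 + n.2)))
    (chargedTerm X y (-((n.1 : ℤ) + 1 + n.2), (n.1 : ℤ) + 1))]

/-- The shortest vectors contribute two elementary terms. -/
lemma orbitSum_zero {X y : ℝ} (hy : 0 < y) :
    orbitSum (chargedTerm X y) 0 = -(exp (-(X / y)) * (1 - 2 * sin (π / (8 * y ^ 2)) ^ 2) +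
      exp (-(X * (y + 1 / (4 * y)))) * (2 * sin (π / (8 * y ^ 2)))) := by
  have hy' := hy.ne'
  have c1 : cos (2 * π * (1 * a2 y - 0 * a1 y)) = -(1 - 2 * sin (π / (8 * y ^ 2)) ^ 2) := by
    have : 2 * π * (1 * a2 y - 0 * a1 y) = π - 2 * (π / (8 * y ^ 2)) := by
      rw [a2]; field_simp; ring
    rw [this, cos_pi_sub, cos_two_mul, cos_sq']; ring
  have c2 : cos (2 * π * (0 * a2 y - (-1) * a1 y)) = - sin (π / (8 * y ^ 2)) := by
    have : 2 * π * (0 * a2 y - (-1) * a1 y) = π / (8 * y ^ 2) + π / 2 := by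
      rw [a1]; field_simp; ring
    rw [this, cos_add_pi_div_two]
  have c3 : cos (2 * π * ((-1) * a2 y - 1 * a1 y)) = - sin (π / (8 * y ^ 2)) := by
    have : 2 * π * ((-1) * a2 y - 1 * a1 y) = (π / (8 * y ^ 2) + π / 2) - 2 * π := by
      rw [a1, a2]; field_simp; ring
    rw [this, cos_sub_two_pi, cos_add_pi_div_two]
  have e : -(X / y) * (1 / 4 + y ^ 2) = -(X * (y + 1 / (4 * y))) := by field_simp; ring
  simp only [orbitSum, chargedTerm, Prod.fst_zero, Prod.snd_zero, Nat.cast_zero, zero_add,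
    Int.cast_one, Int.cast_zero, add_zero, Int.cast_neg, c1, c2, c3]
  rw [show -(X / y) * ((1 : ℝ) ^ 2 + 1 * 0 + (1 / 4 + y ^ 2) * 0 ^ 2) = -(X / y) by ring,
    show -(X / y) * ((0 : ℝ) ^ 2 + 0 * (-1) + (1 / 4 + y ^ 2) * (-1) ^ 2) =
      -(X / y) * (1 / 4 + y ^ 2) by ring,
    show -(X / y) * ((-1 : ℝ) ^ 2 + (-1) * 1 + (1 / 4 + y ^ 2) * 1 ^ 2) =
      -(X / y) * (1 / 4 + y ^ 2) by ring, e]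
  ring

lemma summable_cexp_neg_quadratic {a : ℝ} (ha : 0 < a) (b : ℂ) :
    Summable fun n : ℤ => Complex.exp (-π * a * (n : ℂ) ^ 2 + 2 * π * b * n) := by
  have h := (summable_jacobiTheta₂_term_iff (-Complex.I * b) (Complex.I * a)).2 (by simpa using ha)
  refine h.congr fun n => ?_
  rw [jacobiTheta₂_term]
  congr 1
  linear_combination (-2 * π * b * n + π * a * (n : ℂ) ^ 2) * Complex.I_mul_I

/-- A geometric majorant, over all integers, for a Gaussian centred near a half-integer. -/
lemma hasSum_int_geometric {K r : ℝ} (h0 : 0 ≤ r) (h1 : r < 1) :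
    HasSum (fun n : ℤ => K * r ^ (n.toNat + (-n - 1).toNat)) (K * (2 / (1 - r))) := by
  have h := hasSum_geometric_of_lt_one h0 h1
  have h2 : HasSum (fun n : ℤ => r ^ (n.toNat + (-n - 1).toNat)) ((1 - r)⁻¹ + (1 - r)⁻¹) := by
    refine HasSum.of_nat_of_neg_add_one (h.congr_fun fun n => ?_) (h.congr_fun fun n => ?_)
    · congr 1; omega
    · congr 1; omega
  have e : K * (2 / (1 - r)) = K * ((1 - r)⁻¹ + (1 - r)⁻¹) := by ring
  rw [e]
  exact h2.mul_left K

/-- Poisson summation in the first variable bounds every row of the lattice sum. -/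
lemma abs_tsum_row_le {X y : ℝ} (hX : 0 < X) (hy : 0 < y) (h2 : 12 / 25 ≤ a2 y)
    (h2' : a2 y ≤ 1 / 2) (l : ℤ) :
    |∑' k : ℤ, chargedTerm X y (k, l)| ≤ exp (-(X * y) * (l : ℝ) ^ 2) *
      (√(π * y / X) * (exp (-(23 / 100) * (π ^ 2 * y / X)) *
        (2 / (1 - exp (-(π ^ 2 * y / X)))))) := by
  have hπ := pi_pos
  set a : ℝ := X / (π * y) with ha
  have ha0 : 0 < a := by positivity
  set b : ℂ := -(a2 y : ℂ) * Complex.I - ((a * l / 2 : ℝ) : ℂ) with hb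
  set E : ℤ → ℂ := fun n => Complex.exp (-π * a * (n : ℂ) ^ 2 + 2 * π * b * n) with hE
  set c : ℂ := Complex.exp (((-(X / y) * (1 / 4 + y ^ 2) * (l : ℝ) ^ 2 : ℝ) : ℂ) +
    ((2 * π * l * a1 y : ℝ) : ℂ) * Complex.I) with hc
  have hterm : ∀ k : ℤ, chargedTerm X y (k, l) = (c * E k).re := by
    intro k
    rw [hc, hE]
    simp only
    rw [← Complex.exp_add]
    have : ((-(X / y) * (1 / 4 + y ^ 2) * (l : ℝ) ^ 2 : ℝ) : ℂ) +
        ((2 * π * l * a1 y : ℝ) : ℂ) * Complex.I + (-π * a * (k : ℂ) ^ 2 + 2 * π * b * k) =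
        ((-(X / y) * ((k : ℝ) ^ 2 + (k : ℝ) * (l : ℝ) + (1 / 4 + y ^ 2) * (l : ℝ) ^ 2) : ℝ) : ℂ) +
        ((-(2 * π * ((k : ℝ) * a2 y - (l : ℝ) * a1 y)) : ℝ) : ℂ) * Complex.I := by
      have hXa : X / y = π * a := by rw [ha]; field_simp
      rw [hb, hXa]
      push_cast
      ring
    rw [this, Complex.exp_re]
    simp only [Complex.add_re, Complex.add_im, Complex.ofReal_re, Complex.ofReal_im,
      Complex.re_ofReal_mul, Complex.im_ofReal_mul, Complex.I_re, Complex.I_im, mul_zero,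
      mul_one, add_zero, zero_add, cos_neg]
    rfl
  have hsum : ∑' k : ℤ, chargedTerm X y (k, l) = (c * ∑' k, E k).re := by
    simp_rw [hterm]
    rw [← tsum_mul_left, Complex.re_tsum ((summable_cexp_neg_quadratic ha0 b).mul_left c)]
  have hnc : ‖c‖ = exp (-(X / y) * (1 / 4 + y ^ 2) * (l : ℝ) ^ 2) := by
    rw [hc, Complex.norm_exp]
    simp only [Complex.add_re, Complex.ofReal_re, Complex.re_ofReal_mul, Complex.I_re, mul_zero,
      add_zero]
  have hpoisson := Complex.tsum_exp_neg_quadratic (a := a) (by simpa using ha0) b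
  have hroot : ‖1 / (a : ℂ) ^ (1 / 2 : ℂ)‖ = √(π * y / X) := by
    rw [norm_div, norm_one, Complex.norm_cpow_eq_rpow_re_of_pos ha0]
    have : ((1 / 2 : ℂ)).re = 1 / 2 := by norm_num
    rw [this, ← sqrt_eq_rpow, one_div, ← sqrt_inv, ha, inv_div]
  have hr1 : exp (-(π ^ 2 * y / X)) < 1 := by rw [exp_lt_one_iff, neg_lt_zero]; positivity
  have hgauss : ‖∑' n : ℤ, Complex.exp (-π / a * ((n : ℂ) + Complex.I * b) ^ 2)‖ ≤
      exp (X / y / 4 * (l : ℝ) ^ 2) * exp (-(23 / 100) * (π ^ 2 * y / X)) *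
        (2 / (1 - exp (-(π ^ 2 * y / X)))) := by
    refine tsum_of_norm_bounded (hasSum_int_geometric (exp_pos _).le hr1) fun n => ?_
    rw [Complex.norm_exp, ← exp_nat_mul, ← exp_add, ← exp_add]
    apply exp_le_exp.2
    have hre : (-π / a * ((n : ℂ) + Complex.I * b) ^ 2).re =
        -(π ^ 2 * y / X) * ((n : ℝ) + a2 y) ^ 2 + X / y / 4 * (l : ℝ) ^ 2 := by
      have : (-π / a * ((n : ℂ) + Complex.I * b) ^ 2) =
          ((-π / a * (((n : ℝ) + a2 y) ^ 2 - (a * l / 2) ^ 2) : ℝ) : ℂ) +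
          ((π / a * (2 * ((n : ℝ) + a2 y) * (a * l / 2)) : ℝ) : ℂ) * Complex.I := by
        rw [hb]
        push_cast
        linear_combination (-π / a * ((a2 y : ℂ) ^ 2 * (Complex.I ^ 2 - 1) +
          (a * l / 2) ^ 2 + a2 y * Complex.I * a * l - 2 * a2 y * n)) * Complex.I_mul_I
      rw [this]
      simp only [Complex.add_re, Complex.ofReal_re, Complex.re_ofReal_mul, Complex.I_re,
        mul_zero, add_zero]
      rw [ha]
      field_simp
      ring
    rw [hre]
    have hw : 0 < π ^ 2 * y / X := by positivity
    have hm : 23 / 100 + (((n.toNat + (-n - 1).toNat : ℕ)) : ℝ) ≤ ((n : ℝ) + a2 y) ^ 2 := by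
      rcases le_or_gt 0 n with hn | hn
      · obtain ⟨m, rfl⟩ := Int.eq_ofNat_of_zero_le hn
        have : ((m : ℤ).toNat + (-(m : ℤ) - 1).toNat) = m := by omega
        rw [this]
        push_cast
        rcases Nat.eq_zero_or_pos m with rfl | hm
        · norm_num; nlinarith
        · have : (1 : ℝ) ≤ m := by exact_mod_cast hm
          nlinarith
      · obtain ⟨m, rfl⟩ : ∃ m : ℕ, n = -(m : ℤ) - 1 := ⟨(-n - 1).toNat, by omega⟩
        have : ((-(m : ℤ) - 1).toNat + (-(-(m : ℤ) - 1) - 1).toNat) = m := by omega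
        rw [this]
        push_cast
        have : (0 : ℝ) ≤ m := m.cast_nonneg
        nlinarith
    nlinarith [mul_le_mul_of_nonneg_left hm hw.le]
  rw [hsum]
  refine (Complex.abs_re_le_norm _).trans ?_
  rw [norm_mul, hnc]
  simp only [hE]
  rw [hpoisson, norm_mul, hroot]
  calc _ ≤ exp (-(X / y) * (1 / 4 + y ^ 2) * (l : ℝ) ^ 2) * (√(π * y / X) *
        (exp (X / y / 4 * (l : ℝ) ^ 2) * exp (-(23 / 100) * (π ^ 2 * y / X)) *
        (2 / (1 - exp (-(π ^ 2 * y / X)))))) := by gcongr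
    _ = (exp (-(X / y) * (1 / 4 + y ^ 2) * (l : ℝ) ^ 2) * exp (X / y / 4 * (l : ℝ) ^ 2)) *
        (√(π * y / X) * (exp (-(23 / 100) * (π ^ 2 * y / X)) *
        (2 / (1 - exp (-(π ^ 2 * y / X)))))) := by ring
    _ = _ := by
      rw [← exp_add]
      congr 2
      field_simp
      ring

lemma hasSum_pow_natAbs {z : ℝ} (h0 : 0 ≤ z) (h1 : z < 1) :
    HasSum (fun l : ℤ => z ^ l.natAbs) ((1 + z) / (1 - z)) := by
  have h := hasSum_geometric_of_lt_one h0 h1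
  have e : (1 + z) / (1 - z) = (1 - z)⁻¹ + z * (1 - z)⁻¹ := by ring
  rw [e]
  refine HasSum.of_nat_of_neg_add_one (h.congr_fun fun n => by simp)
    ((h.mul_left z).congr_fun fun n => ?_)
  have : (-((n : ℤ) + 1)).natAbs = n + 1 := by omega
  rw [this, pow_succ']

lemma exp_neg_le_inv_pow {c x : ℝ} (n : ℕ) (hc : c ≤ exp 1) (hc0 : 0 < c) (hx : n ≤ x) :
    exp (-x) ≤ (c ^ n)⁻¹ := by
  rw [exp_neg]
  refine inv_anti₀ (by positivity) ?_
  calc c ^ n ≤ exp 1 ^ n := by gcongr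
    _ = exp n := by rw [← exp_nat_mul, mul_one]
    _ ≤ exp x := exp_le_exp.2 hx

/-- Numerical bound for the Gaussian factor of a row of the dual sum. -/
lemma sqrt_mul_exp_neg_le {u : ℝ} (hu : 251 / 100 ≤ u) :
    0 ≤ √u * (exp (-(23 / 100) * (π * u)) * (2 / (1 - exp (-(π * u))))) ∧
      √u * (exp (-(23 / 100) * (π * u)) * (2 / (1 - exp (-(π * u))))) ≤ 3 / 4 := by
  have hπ := pi_gt_d4
  have hr : exp (-(π * u)) ≤ 1 / 100 :=
    (exp_neg_le_inv_pow (c := 27 / 10) 7 (by linarith [exp_one_gt_d9]) (by norm_num)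
      (by push_cast; nlinarith)).trans (by norm_num)
  have hsq : √u ≤ exp (u / 4) := by
    rw [sqrt_le_left (exp_pos _).le, ← exp_nat_mul]
    have := quadratic_le_exp_of_nonneg (x := u / 2) (by linarith)
    have e : ((2 : ℕ) : ℝ) * (u / 4) = u / 2 := by push_cast; ring
    rw [e]
    nlinarith [sq_nonneg (u - 4)]
  have hprod : √u * exp (-(23 / 100) * (π * u)) ≤ 10 / 27 := by
    calc _ ≤ exp (u / 4) * exp (-(23 / 100) * (π * u)) := by gcongr
      _ = exp (-(23 / 100 * (π * u) - u / 4)) := by rw [← exp_add]; ring_nf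
      _ ≤ ((27 / 10) ^ 1)⁻¹ := exp_neg_le_inv_pow 1 (by linarith [exp_one_gt_d9]) (by norm_num)
          (by push_cast; nlinarith)
      _ = _ := by norm_num
  have h0 : 0 ≤ 2 / (1 - exp (-(π * u))) := div_nonneg zero_le_two (by linarith)
  have h1 : 2 / (1 - exp (-(π * u))) ≤ 200 / 99 := by
    rw [div_le_div_iff₀] <;> linarith
  refine ⟨by positivity, ?_⟩
  rw [← mul_assoc]
  exact (mul_le_mul hprod h1 h0 (by norm_num)).trans (by norm_num)

/-- When `y` is large compared with `α`, the dual sum shows that `gTheta` is small. -/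
lemma gTheta_le_of_le_mul {α y : ℝ} (hα : 1 ≤ α) (hy : 0 < y) (h : π * α ≤ 5 / 4 * y) :
    gTheta α y ≤ 9 / 10 := by
  have hπ := pi_gt_d4
  obtain ⟨X, hX⟩ : ∃ X, X = π * α := ⟨_, rfl⟩
  rw [← hX] at h
  have hXπ : π ≤ X := by nlinarith
  have hX0 : 0 < X := by linarith
  have hy1 : 251 / 100 ≤ y := by linarith
  have hy2 : 3 / 4 ≤ y ^ 2 := by nlinarith
  have hinv : 1 / (8 * y ^ 2) ≤ 1 / 50 := by
    apply one_div_le_one_div_of_le <;> nlinarith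
  have ha : 12 / 25 ≤ a2 y := by rw [a2]; linarith
  have ha' : a2 y ≤ 1 / 2 := by rw [a2]; linarith [show 0 ≤ 1 / (8 * y ^ 2) by positivity]
  have hu : 251 / 100 ≤ π * y / X := by
    rw [le_div_iff₀ hX0]; nlinarith
  obtain ⟨hB0, hB1⟩ := sqrt_mul_exp_neg_le hu
  have hrow := abs_tsum_row_le hX0 hy ha ha'
  rw [show π ^ 2 * y / X = π * (π * y / X) by ring] at hrow
  generalize √(π * y / X) * (exp (-(23 / 100) * (π * (π * y / X))) *
    (2 / (1 - exp (-(π * (π * y / X)))))) = B at hB0 hB1 hrow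
  have hs := summable_chargedTerm hX0 hy hy2
  have hs' : Summable fun p : ℤ × ℤ => chargedTerm X y (p.2, p.1) :=
    (Equiv.prodComm ℤ ℤ).summable_iff.2 hs
  have hF : gTheta α y = ∑' l : ℤ, ∑' k : ℤ, chargedTerm X y (k, l) := by
    rw [← hs'.tsum_prod' hs'.prod_factor, hX]
    exact ((Equiv.prodComm ℤ ℤ).tsum_eq (chargedTerm (π * α) y)).symm
  have hXy : 7 ≤ X * y := by nlinarith
  have hz2 : exp (-(X * y)) ≤ 1 / 100 :=
    (exp_neg_le_inv_pow (c := 27 / 10) 7 (by linarith [exp_one_gt_d9]) (by norm_num)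
      (by exact_mod_cast hXy)).trans (by norm_num)
  have hz0 : 0 < exp (-(X * y)) := exp_pos _
  have hbound : ‖∑' l : ℤ, ∑' k : ℤ, chargedTerm X y (k, l)‖ ≤
      B * ((1 + exp (-(X * y))) / (1 - exp (-(X * y)))) := by
    refine tsum_of_norm_bounded ((hasSum_pow_natAbs hz0.le (by linarith)).mul_left B) fun l => ?_
    refine (hrow l).trans ?_
    rw [mul_comm]
    refine mul_le_mul_of_nonneg_left ?_ hB0
    rw [← exp_nat_mul]
    apply exp_le_exp.2
    nlinarith [mul_le_mul_of_nonneg_left (natAbs_le_sq l) (show 0 ≤ X * y by linarith)]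
  have hz : (1 + exp (-(X * y))) / (1 - exp (-(X * y))) ≤ 6 / 5 := by
    rw [div_le_iff₀] <;> linarith
  rw [hF]
  refine (le_abs_self _).trans (hbound.trans ?_)
  refine (mul_le_mul hB1 hz (div_nonneg (by linarith) (by linarith)) (by norm_num)).trans ?_
  norm_num

/-- Numerical bound for the part of the sector away from its vertex. -/
lemma sector_tail_le {z z₀ c : ℝ} (h0 : 0 ≤ z) (hz : z ≤ z₀) (h1 : z₀ < 1)
    (h : 1 ≤ (1 + c) * ((1 - z₀ ^ 2) * (1 - z₀ ^ 3))) (hc : 0 ≤ c) :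
    z / ((1 - z ^ 2) * (1 - z ^ 3)) - z ≤ c * z := by
  have h2 : z₀ ^ 2 < 1 := pow_lt_one₀ (h0.trans hz) h1 two_ne_zero
  have h3 : z₀ ^ 3 < 1 := pow_lt_one₀ (h0.trans hz) h1 three_ne_zero
  have hz2 : z ^ 2 ≤ z₀ ^ 2 := by gcongr
  have hz3 : z ^ 3 ≤ z₀ ^ 3 := by gcongr
  have hD : 0 < (1 - z ^ 2) * (1 - z ^ 3) := mul_pos (by linarith) (by linarith)
  have : 1 ≤ (1 + c) * ((1 - z ^ 2) * (1 - z ^ 3)) := h.trans <| by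
    gcongr
    linarith
  rw [sub_le_iff_le_add, div_le_iff₀ hD]
  nlinarith

lemma gTheta_hexagonal_ge {α y₀ : ℝ} (hα : 1 ≤ α) (h0 : 0 < y₀) (h2 : y₀ ^ 2 = 3 / 4)
    (hρ : exp (-(π * α / y₀)) ≤ 1 / 36) :
    1 - 3.01 * exp (-(π * α / y₀)) ≤ gTheta α y₀ := by
  obtain ⟨hs, hg⟩ := gTheta_eq_orbitSum (α := α) (by linarith) h0 h2.ge
  have hX : 0 < π * α := by have := pi_pos; positivity
  set X := π * α
  set ρ := exp (-(X / y₀)) with hρd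
  have hpos : 0 < ρ := exp_pos _
  have hle := tsum_le_of_le_mul_pow_hexNorm (C := 3) (z := ρ) hs.neg (by norm_num) hpos.le
    (by linarith) fun n _ => (neg_le_abs _).trans (abs_orbitSum_le hX h0 h2.ge n)
  rw [tsum_neg] at hle
  have htail := sector_tail_le (c := 1 / 1000) hpos.le hρ (by norm_num) (by norm_num) (by norm_num)
  have hv := orbitSum_zero (X := X) h0
  have e1 : π / (8 * y₀ ^ 2) = π / 6 := by rw [h2]; ring
  have e2 : y₀ + 1 / (4 * y₀) = 1 / y₀ := by
    field_simp
    linarith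
  rw [e1, e2, sin_pi_div_six, mul_one_div, ← hρd] at hv
  rw [hg]
  linarith

lemma gTheta_le_far {α y : ℝ} (hα : 1 ≤ α) (hy : 0 < y) (hy2 : 3 / 4 ≤ y ^ 2) {c q₀ : ℝ}
    (hq : exp (-(π * α / y)) ≤ q₀) (h1 : q₀ < 1)
    (h : 1 ≤ (1 + c) * ((1 - q₀ ^ 2) * (1 - q₀ ^ 3))) (hc : 0 ≤ c) :
    gTheta α y ≤ 1 - (2 - 4 * (π / (8 * y ^ 2)) ^ 2 - 6 * c) * exp (-(π * α / y)) := by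
  obtain ⟨hs, hg⟩ := gTheta_eq_orbitSum (α := α) (by linarith) hy hy2
  have hX : 0 < π * α := by have := pi_pos; positivity
  set X := π * α
  set q := exp (-(X / y)) with hqd
  have hpos : 0 < q := exp_pos _
  have hle := tsum_le_of_le_mul_pow_hexNorm (C := 3) (z := q) hs (by norm_num) hpos.le
    (by linarith) fun n _ => (le_abs_self _).trans (abs_orbitSum_le hX hy hy2 n)
  have htail := sector_tail_le hpos.le hq h1 h hc
  have hv := orbitSum_zero (X := X) hy
  set s := π / (8 * y ^ 2) with hsd
  have hs0 : 0 ≤ s := by have := pi_pos; positivity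
  have hs1 : s ≤ π := by
    rw [hsd, div_le_iff₀ (by positivity)]; nlinarith [pi_pos]
  have hsin0 := sin_nonneg_of_nonneg_of_le_pi hs0 hs1
  have hsin := sin_le hs0
  have hsq : sin s ^ 2 ≤ s ^ 2 := by gcongr
  have hpos2 : 0 ≤ exp (-(X * (y + 1 / (4 * y)))) * (2 * sin s) := by positivity
  rw [hg]
  nlinarith [mul_le_mul_of_nonneg_right hsq hpos.le]

lemma gTheta_le_hexagonal_of_far {α y y₀ : ℝ} (hα : 1 ≤ α) (h0 : 0 < y₀) (h2 : y₀ ^ 2 = 3 / 4)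
    (hy : 11 / 10 ≤ y) : gTheta α y ≤ gTheta α y₀ := by
  have hπ := pi_gt_d4
  have hπ' := pi_lt_d4
  have hX : π ≤ π * α := by nlinarith
  have he1 := exp_one_gt_d9
  have hy₀ : y₀ ≤ 0.86603 := by nlinarith
  have hy₀' : 0.866 ≤ y₀ := by nlinarith
  have hinv : 1.1546 ≤ 1 / y₀ := by rw [le_div_iff₀ h0]; nlinarith
  have hy0 : 0 < y := by linarith
  have hy2 : 3 / 4 ≤ y ^ 2 := by nlinarith
  have hρ : exp (-(π * α / y₀)) ≤ 1 / 36 := by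
    have h36 : 36 ≤ exp 3.62 := by
      have e : (3.62 : ℝ) = 3 + 0.62 := by norm_num
      have h3 : exp 3 = exp 1 ^ 3 := by rw [← exp_nat_mul]; norm_num
      have h4 : (2.718 : ℝ) ^ 3 ≤ exp 1 ^ 3 := by gcongr; linarith
      have h5 := sum_le_exp_of_nonneg (x := 0.62) (by norm_num) 4
      norm_num [Finset.sum_range_succ, Nat.factorial] at h5
      rw [e, exp_add, h3]
      norm_num at h4 ⊢
      nlinarith
    rw [exp_neg, one_div]
    refine inv_anti₀ (by norm_num) (h36.trans (exp_le_exp.2 ?_))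
    rw [div_eq_mul_one_div]
    nlinarith
  have hbase := gTheta_hexagonal_ge hα h0 h2 hρ
  have hs : π / (8 * y ^ 2) * y ^ 2 = π / 8 := by field_simp
  have hs0 : 0 ≤ π / (8 * y ^ 2) := by positivity
  rcases le_or_gt (π * α) (5 / 4 * y) with h | h
  · exact (gTheta_le_of_le_mul hα hy0 h).trans (by linarith)
  rcases le_or_gt (2 * y) (π * α) with h' | h'
  · have hq : exp (-(π * α / y)) ≤ (2.71 ^ 2)⁻¹ :=
      exp_neg_le_inv_pow 2 (by linarith) (by norm_num)
        (by rw [le_div_iff₀ hy0]; exact_mod_cast h')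
    have hfar := gTheta_le_far (c := 0.022) hα hy0 hy2 hq (by norm_num) (by norm_num) (by norm_num)
    have hratio : 2.15 * exp (-(π * α / y₀)) ≤ exp (-(π * α / y)) := by
      have h77 : 2.15 ≤ exp 0.77 := by
        have h5 := sum_le_exp_of_nonneg (x := 0.77) (by norm_num) 5
        norm_num [Finset.sum_range_succ, Nat.factorial] at h5
        norm_num
        linarith
      calc _ ≤ exp 0.77 * exp (-(π * α / y₀)) := by gcongr
        _ = exp (0.77 - π * α / y₀) := by rw [← exp_add]; ring_nf
        _ ≤ _ := by
          apply exp_le_exp.2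
          have : 1 / y ≤ 10 / 11 := by
            rw [div_le_div_iff₀ hy0 (by norm_num)]; linarith
          rw [div_eq_mul_one_div (π * α), div_eq_mul_one_div (π * α)]
          nlinarith
    have hsb : π / (8 * y ^ 2) ≤ 0.3246 := by
      rw [div_le_iff₀ (by positivity)]; nlinarith
    have hsb2 : (π / (8 * y ^ 2)) ^ 2 ≤ 0.3246 ^ 2 := by gcongr
    have := mul_le_mul_of_nonneg_right hsb2 (exp_pos (-(π * α / y))).le
    linarith [exp_pos (-(π * α / y))]
  · have hq : exp (-(π * α / y)) ≤ 0.288 := by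
      have h5 := sum_le_exp_of_nonneg (x := 1.25) (by norm_num) 7
      norm_num [Finset.sum_range_succ, Nat.factorial] at h5
      rw [exp_neg]
      refine (inv_anti₀ (by norm_num : (0:ℝ) < 3.48) (?_)).trans (by norm_num)
      refine le_trans ?_ (exp_le_exp.2 (show 1.25 ≤ π * α / y by rw [le_div_iff₀ hy0]; linarith))
      norm_num
      linarith
    have hfar := gTheta_le_far (c := 0.12) hα hy0 hy2 hq (by norm_num) (by norm_num) (by norm_num)
    have hq' : 0.129 ≤ exp (-(π * α / y)) := by
      have h2 : exp (-2) ≤ exp (-(π * α / y)) := by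
        apply exp_le_exp.2
        rw [neg_le_neg_iff, div_le_iff₀ hy0]; linarith
      have h3 : (0.36 : ℝ) ≤ exp (-1) := by
        have := exp_neg_one_gt_d9
        linarith
      have h4 : exp (-2) = exp (-1) * exp (-1) := by rw [← exp_add]; norm_num
      nlinarith
    have hsb : π / (8 * y ^ 2) ≤ 0.17 := by
      rw [div_le_iff₀ (by positivity)]; nlinarith
    have hsb2 : (π / (8 * y ^ 2)) ^ 2 ≤ 0.17 ^ 2 := by gcongr
    have := mul_le_mul_of_nonneg_right hsb2 (exp_pos (-(π * α / y))).le
    linarith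

lemma cos_add_le (ψ η : ℝ) : cos (ψ + η) ≤ cos ψ - η * sin ψ + η ^ 2 / 2 := by
  have hd : ∀ t : ℝ, HasDerivAt (fun t : ℝ => t ^ 2 / 2 - cos t) (t + sin t) t := fun t => by
    have := ((hasDerivAt_pow 2 t).div_const 2).sub (hasDerivAt_cos t)
    exact this.congr_deriv (by push_cast; ring)
  have hderiv : deriv (fun t : ℝ => t ^ 2 / 2 - cos t) = fun t => t + sin t :=
    funext fun t => (hd t).deriv
  have hmono : Monotone fun t : ℝ => t + sin t := fun a b hab => by
    have h := abs_sin_sub_sin_le a b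
    rw [abs_sub_comm a b, abs_of_nonneg (sub_nonneg.2 hab)] at h
    have := (le_abs_self _).trans h
    simp only
    linarith
  have hconv : ConvexOn ℝ Set.univ fun t : ℝ => t ^ 2 / 2 - cos t :=
    Monotone.convexOn_univ_of_deriv (fun t => (hd t).differentiableAt) (hderiv ▸ hmono)
  rcases lt_trichotomy η 0 with h | rfl | h
  · have := hconv.slope_le_of_hasDerivAt (Set.mem_univ (ψ + η)) (Set.mem_univ ψ)
      (by linarith) (hd ψ)
    rw [slope_def_field, div_le_iff₀ (by linarith)] at this
    nlinarith
  · simp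
  · have := hconv.le_slope_of_hasDerivAt (Set.mem_univ ψ) (Set.mem_univ (ψ + η))
      (by linarith) (hd ψ)
    rw [slope_def_field, le_div_iff₀ (by linarith)] at this
    nlinarith

/-- A quantitative first-order expansion of `exp (-x) * cos (ψ + η)` at the origin. -/
lemma mul_exp_mul_cos_sub_le {P Q x : ℝ} (ψ η : ℝ) (hP : 0 ≤ P) (hPQ : P ≤ Q)
    (hPQ' : P * exp (-x) ≤ Q) :
    P * (exp (-x) * cos (ψ + η)) - P * cos ψ ≤
      -(P * cos ψ) * x - (P * sin ψ) * η + Q * (3 / 2 * x ^ 2 + η ^ 2) := by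
  have hQ : 0 ≤ Q := hP.trans hPQ
  have hexp0 : 0 ≤ exp (-x) - 1 + x := by linarith [add_one_le_exp (-x)]
  have hexp : P * (exp (-x) - 1 + x) ≤ Q * x ^ 2 := by
    rcases le_total 0 x with hx | hx
    · have h1 : exp (-x) - 1 + x ≤ x ^ 2 := by
        have h2 : exp (-x) * (1 + x) ≤ 1 := by
          have := mul_le_mul_of_nonneg_left (add_one_le_exp x) (exp_pos (-x)).le
          rw [← exp_add] at this
          simpa [add_comm] using this
        nlinarith [exp_pos (-x), exp_le_one_iff.2 (neg_nonpos.2 hx)]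
      exact mul_le_mul hPQ h1 hexp0 hQ
    · have h1 : exp (-x) - 1 + x ≤ exp (-x) * x ^ 2 := by
        have h2 : exp (-x) * exp x = 1 := by rw [← exp_add]; simp
        have h3 : exp (-x) * (1 + x) ≤ 1 := by
          rw [← h2]
          exact mul_le_mul_of_nonneg_left (by linarith [add_one_le_exp x]) (exp_pos _).le
        nlinarith
      calc _ ≤ P * (exp (-x) * x ^ 2) := by gcongr
        _ = P * exp (-x) * x ^ 2 := by ring
        _ ≤ _ := by gcongr
  have hA : P * (exp (-x) - 1 + x) * cos (ψ + η) ≤ Q * x ^ 2 :=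
    (mul_le_of_le_one_right (mul_nonneg hP hexp0) (cos_le_one _)).trans hexp
  have hB : P * (-x * (cos (ψ + η) - cos ψ)) ≤ Q * ((x ^ 2 + η ^ 2) / 2) := by
    have h1 : -x * (cos (ψ + η) - cos ψ) ≤ (x ^ 2 + η ^ 2) / 2 := by
      have h2 : (cos (ψ + η) - cos ψ) ^ 2 ≤ η ^ 2 := by
        rw [sq_le_sq]
        simpa using abs_cos_sub_cos_le (ψ + η) ψ
      nlinarith [sq_nonneg (x + (cos (ψ + η) - cos ψ))]
    exact (mul_le_mul_of_nonneg_left h1 hP).trans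
      (mul_le_mul_of_nonneg_right hPQ (by positivity))
  have hC : P * (cos (ψ + η) - cos ψ + η * sin ψ) ≤ Q * (η ^ 2 / 2) :=
    (mul_le_mul_of_nonneg_left (by linarith [cos_add_le ψ η]) hP).trans
      (mul_le_mul_of_nonneg_right hPQ (by positivity))
  linear_combination hA + hB + hC

/-- First-order comparison of a single term at `y` with the same term at the hexagonal point. -/
lemma chargedTerm_sub_le {X y y₀ : ℝ} (hX : 0 < X) (h0 : 0 < y₀) (h2 : y₀ ^ 2 = 3 / 4)
    (hy : y₀ ≤ y) (k l : ℤ) {M ψ x η : ℝ} (hM : (k : ℝ) ^ 2 + k * l + (l : ℝ) ^ 2 = M)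
    (hc : cos (2 * π / 3 * (k - l)) = cos ψ) (hs : sin (2 * π / 3 * (k - l)) = sin ψ)
    (hx : x = X * (y - y₀) / y * ((y + y₀) * (l : ℝ) ^ 2 - M / y₀))
    (hη : η = π * ((y - y₀) * (y + y₀) / (6 * y ^ 2)) * (2 * k + l)) :
    chargedTerm X y (k, l) - chargedTerm X y₀ (k, l) ≤
      -(exp (-(X / y₀) * M) * cos ψ) * x - (exp (-(X / y₀) * M) * sin ψ) * η +
        exp (-(X / y) * M) * (3 / 2 * x ^ 2 + η ^ 2) := by
  have hy0 : 0 < y := h0.trans_le hy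
  have hy0' := hy0.ne'
  have h0' := h0.ne'
  have hM0 : 0 ≤ M := by
    rw [← hM]
    nlinarith [sq_nonneg ((k : ℝ) + l), sq_nonneg (k : ℝ), sq_nonneg (l : ℝ)]
  have hy2 : 3 / 4 ≤ y ^ 2 := by nlinarith
  have hQ : -(X / y) * ((k : ℝ) ^ 2 + k * l + (1 / 4 + y ^ 2) * (l : ℝ) ^ 2) =
      -(X / y₀) * M + -x := by
    have hk : (k : ℝ) ^ 2 + k * l + (1 / 4 + y ^ 2) * (l : ℝ) ^ 2 =
        M + (y - y₀) * (y + y₀) * (l : ℝ) ^ 2 := by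
      rw [← hM]
      linear_combination (l : ℝ) ^ 2 * h2
    rw [hk, hx]
    field_simp
    ring
  have hQ₀ : -(X / y₀) * ((k : ℝ) ^ 2 + k * l + (1 / 4 + y₀ ^ 2) * (l : ℝ) ^ 2) =
      -(X / y₀) * M := by
    rw [h2, ← hM]; ring
  have hphase : 2 * π * ((k : ℝ) * a2 y - (l : ℝ) * a1 y) = 2 * π / 3 * (k - l) + η := by
    have : (y - y₀) * (y + y₀) = y ^ 2 - 3 / 4 := by rw [← h2]; ring
    rw [hη, this, a1, a2]
    field_simp
    ring
  have hphase₀ : 2 * π * ((k : ℝ) * a2 y₀ - (l : ℝ) * a1 y₀) = 2 * π / 3 * (k - l) := by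
    rw [a1, a2, h2]
    ring
  have hP : exp (-(X / y₀) * M) ≤ exp (-(X / y) * M) := by
    apply exp_le_exp.2
    have : X / y ≤ X / y₀ := by gcongr
    nlinarith
  have hP' : exp (-(X / y₀) * M) * exp (-x) ≤ exp (-(X / y) * M) := by
    rw [← exp_add, ← hQ]
    apply exp_le_exp.2
    have : 0 < X / y := by positivity
    rw [← hM]
    nlinarith [mul_nonneg (mul_nonneg this.le (sub_nonneg.2 hy2)) (sq_nonneg (l : ℝ))]
  have key := mul_exp_mul_cos_sub_le ψ η (exp_pos _).le hP hP'
  have hy' : chargedTerm X y (k, l) = exp (-(X / y₀) * M) * (exp (-x) * cos (ψ + η)) := by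
    simp only [chargedTerm]
    rw [hQ, hphase, exp_add, cos_add, cos_add, hc, hs]
    ring
  have hy₀' : chargedTerm X y₀ (k, l) = exp (-(X / y₀) * M) * cos ψ := by
    simp only [chargedTerm]
    rw [hQ₀, hphase₀, hc]
  rw [hy', hy₀']
  exact key

/-- The coefficients of the expansion on an orbit, compared with `X ^ 2 * (y - y₀) ^ 2`. -/
lemma firstOrder_bounds {X y y₀ b e : ℝ} (hX : π ≤ X) (h0 : 0 < y₀) (h2 : y₀ ^ 2 = 3 / 4)
    (hy : y₀ ≤ y) (hb : b = X * (y - y₀) / y)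
    (he : e = π * ((y - y₀) * (y + y₀) / (6 * y ^ 2))) :
    b ^ 2 * (2 * (y + y₀) ^ 2 - 16 / 3 * y₀ * (y + y₀) + 4) ≤
        8 / 3 * (X ^ 2 * (y - y₀) ^ 2) ∧
      6 * e ^ 2 ≤ 8 / 9 * (X ^ 2 * (y - y₀) ^ 2) ∧
      2 * b * (y - y₀) ≤ 0.74 * (X ^ 2 * (y - y₀) ^ 2) := by
  have hπ := pi_gt_d4
  have hX0 : 0 < X := by linarith
  have hy0 : 0 < y := h0.trans_le hy
  have hy₀' : 0.866 ≤ y₀ := by nlinarith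
  have hh : 0 ≤ y - y₀ := sub_nonneg.2 hy
  have hb0 : 0 ≤ b := hb ▸ by positivity
  have hby : b * y = X * (y - y₀) := by rw [hb]; field_simp
  have hbb : b * y₀ ≤ X * (y - y₀) := by
    rw [← hby]; gcongr
  refine ⟨?_, ?_, ?_⟩
  · have h1 : X ^ 2 * (y - y₀) ^ 2 = b ^ 2 * y ^ 2 := by rw [← mul_pow, ← mul_pow, hby]
    have h3 : 2 * (y + y₀) ^ 2 - 16 / 3 * y₀ * (y + y₀) + 4 ≤ 8 / 3 * y ^ 2 := by nlinarith
    rw [h1]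
    nlinarith [mul_le_mul_of_nonneg_left h3 (sq_nonneg b)]
  · have h1 : (y + y₀) / y ^ 2 ≤ 2 / y₀ := by
      rw [div_le_div_iff₀ (by positivity) h0]; nlinarith
    have h3 : e ≤ X * (y - y₀) * (1 / (3 * y₀)) := by
      rw [he]
      calc _ = π * (y - y₀) * ((y + y₀) / y ^ 2 / 6) := by field_simp
        _ ≤ X * (y - y₀) * (2 / y₀ / 6) := by gcongr
        _ = _ := by ring
    have h4 : 0 ≤ e := he ▸ by positivity
    have h5 : e ^ 2 ≤ (X * (y - y₀) * (1 / (3 * y₀))) ^ 2 := by gcongr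
    have h6 : (X * (y - y₀) * (1 / (3 * y₀))) ^ 2 = 4 / 27 * (X ^ 2 * (y - y₀) ^ 2) := by
      rw [mul_pow, div_pow, mul_pow, mul_pow, h2]; ring
    linarith
  · have h1 : b * 0.866 ≤ X * (y - y₀) :=
      (mul_le_mul_of_nonneg_left hy₀' hb0).trans hbb
    have h3 : b * (y - y₀) * 0.866 ≤ X * (y - y₀) ^ 2 := by
      linear_combination mul_le_mul_of_nonneg_right h1 hh
    have h4 : 3.1415 * (X * (y - y₀) ^ 2) ≤ X ^ 2 * (y - y₀) ^ 2 := by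
      have : 3.1415 ≤ X := by linarith
      have h5 : 0 ≤ X * (y - y₀) ^ 2 := by positivity
      linear_combination mul_le_mul_of_nonneg_right this h5
    linarith

/-- Summing the expansions over an orbit, the first-order phase terms cancel. -/
lemma expansion_sum_eq {y₀ K L M : ℝ} (h2 : y₀ ^ 2 = 3 / 4) (hM : K ^ 2 + K * L + L ^ 2 = M)
    (y A B Q b e : ℝ) :
    -A * (b * ((y + y₀) * L ^ 2 - 4 / 3 * y₀ * M)) - B * (e * (2 * K + L)) +
        Q * (3 / 2 * (b * ((y + y₀) * L ^ 2 - 4 / 3 * y₀ * M)) ^ 2 + (e * (2 * K + L)) ^ 2) +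
      (-A * (b * ((y + y₀) * (-(K + L)) ^ 2 - 4 / 3 * y₀ * M)) - B * (e * (2 * L + -(K + L))) +
        Q * (3 / 2 * (b * ((y + y₀) * (-(K + L)) ^ 2 - 4 / 3 * y₀ * M)) ^ 2 +
          (e * (2 * L + -(K + L))) ^ 2)) +
      (-A * (b * ((y + y₀) * K ^ 2 - 4 / 3 * y₀ * M)) - B * (e * (2 * -(K + L) + K)) +
        Q * (3 / 2 * (b * ((y + y₀) * K ^ 2 - 4 / 3 * y₀ * M)) ^ 2 +
          (e * (2 * -(K + L) + K)) ^ 2)) =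
    -A * (2 * b * (y - y₀) * M) +
      Q * (3 / 2 * (b ^ 2 * M ^ 2 * (2 * (y + y₀) ^ 2 - 16 / 3 * y₀ * (y + y₀) + 4)) +
        6 * e ^ 2 * M) := by
  rw [← hM]
  linear_combination (Q * (3 / 2) * b ^ 2 * (16 / 3) * (K ^ 2 + K * L + L ^ 2) ^ 2) * h2

/-- The first-order terms cancel on every orbit of the rotation of order three. -/
lemma orbitSum_sub_le_expansion {X y y₀ : ℝ} (hX : 0 < X) (h0 : 0 < y₀) (h2 : y₀ ^ 2 = 3 / 4)
    (hy : y₀ ≤ y) {n : ℕ × ℕ} {M b e : ℝ} (hM : M = hexNorm n)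
    (hb : b = X * (y - y₀) / y) (he : e = π * ((y - y₀) * (y + y₀) / (6 * y ^ 2))) :
    orbitSum (chargedTerm X y) n - orbitSum (chargedTerm X y₀) n ≤
      exp (-(X / y) * M) * (2 * b * (y - y₀) * M +
        (3 / 2 * (b ^ 2 * M ^ 2 * (2 * (y + y₀) ^ 2 - 16 / 3 * y₀ * (y + y₀) + 4)) +
          6 * e ^ 2 * M)) := by
  have hy0 : 0 < y := h0.trans_le hy
  have hM0 : 0 ≤ M := hM ▸ Nat.cast_nonneg _
  obtain ⟨K, hK⟩ : ∃ K : ℤ, K = (n.1 : ℤ) + 1 := ⟨_, rfl⟩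
  obtain ⟨L, hL⟩ : ∃ L : ℤ, L = (n.2 : ℤ) := ⟨_, rfl⟩
  have hKL : (K : ℝ) ^ 2 + K * L + (L : ℝ) ^ 2 = M := by
    rw [hM, hK, hL, hexNorm]; push_cast; ring
  obtain ⟨ψ, hψ⟩ : ∃ ψ : ℝ, ψ = 2 * π / 3 * (K - L) := ⟨_, rfl⟩
  have hph1 : 2 * π / 3 * (((L : ℤ) : ℝ) - ((-(K + L) : ℤ) : ℝ)) = ψ + L * (2 * π) := by
    rw [hψ]; push_cast; ring
  have hph2 : 2 * π / 3 * (((-(K + L) : ℤ) : ℝ) - ((K : ℤ) : ℝ)) = ψ - K * (2 * π) := by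
    rw [hψ]; push_cast; ring
  have t0 := chargedTerm_sub_le hX h0 h2 hy K L hKL (by rw [hψ]) (by rw [hψ]) (ψ := ψ) rfl rfl
  have t1 := chargedTerm_sub_le hX h0 h2 hy L (-(K + L)) (M := M) (ψ := ψ)
    (by rw [← hKL]; push_cast; ring) (by rw [hph1, cos_add_int_mul_two_pi])
    (by rw [hph1, sin_add_int_mul_two_pi]) rfl rfl
  have t2 := chargedTerm_sub_le hX h0 h2 hy (-(K + L)) K (M := M) (ψ := ψ)
    (by rw [← hKL]; push_cast; ring) (by rw [hph2, cos_sub_int_mul_two_pi])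
    (by rw [hph2, sin_sub_int_mul_two_pi]) rfl rfl
  rw [← hb, ← he] at t0 t1 t2
  push_cast at t0 t1 t2
  have hsub : orbitSum (chargedTerm X y) n - orbitSum (chargedTerm X y₀) n =
      (chargedTerm X y (K, L) - chargedTerm X y₀ (K, L)) +
      (chargedTerm X y (L, -(K + L)) - chargedTerm X y₀ (L, -(K + L))) +
      (chargedTerm X y (-(K + L), K) - chargedTerm X y₀ (-(K + L), K)) := by
    rw [hK, hL]
    simp only [orbitSum]
    ring
  have hyinv : 1 / y₀ = 4 / 3 * y₀ := by field_simp; linarith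
  have hMy : M / y₀ = 4 / 3 * y₀ * M := by rw [← hyinv]; ring
  rw [hMy] at t0 t1 t2
  have hPq : exp (-(X / y₀) * M) ≤ exp (-(X / y) * M) := by
    apply exp_le_exp.2
    have : X / y ≤ X / y₀ := by gcongr
    nlinarith
  obtain ⟨P, hP⟩ : ∃ P, P = exp (-(X / y₀) * M) := ⟨_, rfl⟩
  obtain ⟨Q, hQ⟩ : ∃ Q, Q = exp (-(X / y) * M) := ⟨_, rfl⟩
  rw [← hP, ← hQ] at t0 t1 t2 hPq
  have hP0 : 0 < P := hP ▸ exp_pos _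
  have hbound : orbitSum (chargedTerm X y) n - orbitSum (chargedTerm X y₀) n ≤
      -(P * cos ψ) * (2 * b * (y - y₀) * M) +
      Q * (3 / 2 * (b ^ 2 * M ^ 2 * (2 * (y + y₀) ^ 2 - 16 / 3 * y₀ * (y + y₀) + 4)) +
        6 * e ^ 2 * M) := by
    rw [hsub]
    refine (add_le_add (add_le_add t0 t1) t2).trans (le_of_eq ?_)
    exact expansion_sum_eq h2 hKL _ _ _ _ _ _
  have hh : 0 ≤ y - y₀ := sub_nonneg.2 hy
  have hb0 : 0 ≤ b := hb ▸ by positivity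
  have h1 : -(P * cos ψ) ≤ Q := by
    linarith [mul_le_mul_of_nonneg_left (neg_one_le_cos ψ) hP0.le]
  have h3 : 0 ≤ 2 * b * (y - y₀) * M := by positivity
  rw [← hQ]
  linarith [mul_le_mul_of_nonneg_right h1 h3]

/-- The nontrivial orbits contribute only at second order in `y - y₀`. -/
lemma orbitSum_sub_le {X y y₀ : ℝ} (hX : π ≤ X) (h0 : 0 < y₀) (h2 : y₀ ^ 2 = 3 / 4)
    (hy : y₀ ≤ y) {n : ℕ × ℕ} (hn : n ≠ 0) :
    orbitSum (chargedTerm X y) n - orbitSum (chargedTerm X y₀) n ≤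
      5.12 * X ^ 2 * (y - y₀) ^ 2 * (2 * exp (-(X / y))) ^ hexNorm n := by
  have hM3 : (3 : ℝ) ≤ hexNorm n := by exact_mod_cast three_le_hexNorm hn
  obtain ⟨M, hM⟩ : ∃ M : ℝ, M = hexNorm n := ⟨_, rfl⟩
  rw [← hM] at hM3
  obtain ⟨b, hb⟩ : ∃ b, b = X * (y - y₀) / y := ⟨_, rfl⟩
  obtain ⟨e, he⟩ : ∃ e, e = π * ((y - y₀) * (y + y₀) / (6 * y ^ 2)) := ⟨_, rfl⟩
  have hbound := orbitSum_sub_le_expansion (pi_pos.trans_le hX) h0 h2 hy hM hb he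
  obtain ⟨hquad, he2, hlin⟩ := firstOrder_bounds hX h0 h2 hy hb he
  obtain ⟨Q, hQ⟩ : ∃ Q, Q = exp (-(X / y) * M) := ⟨_, rfl⟩
  have hQ0 : 0 ≤ Q := hQ ▸ (exp_pos _).le
  rw [← hQ] at hbound
  have hM1 : M ≤ M ^ 2 / 3 := by nlinarith
  obtain ⟨D, hD⟩ : ∃ D, D = X ^ 2 * (y - y₀) ^ 2 := ⟨_, rfl⟩
  rw [← hD] at hquad he2 hlin
  have hD0 : 0 ≤ D := hD ▸ by positivity
  have hfirst : 2 * b * (y - y₀) * M ≤ 0.74 * D * (M ^ 2 / 3) := by gcongr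
  have hsecond : 3 / 2 * (b ^ 2 * M ^ 2 * (2 * (y + y₀) ^ 2 - 16 / 3 * y₀ * (y + y₀) + 4)) +
        6 * e ^ 2 * M ≤ 4 * D * M ^ 2 + 8 / 9 * D * (M ^ 2 / 3) := by
    have h1 : 6 * e ^ 2 * M ≤ 8 / 9 * D * (M ^ 2 / 3) := by gcongr
    nlinarith [mul_le_mul_of_nonneg_right hquad (sq_nonneg M)]
  have hpow : M ^ 2 ≤ 9 / 8 * 2 ^ hexNorm n := by
    have : ∀ m : ℕ, 3 ≤ m → 8 * m ^ 2 ≤ 9 * 2 ^ m := fun m hm => by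
      induction m, hm using Nat.le_induction with
      | base => norm_num
      | succ m hm ih => rw [pow_succ 2]; nlinarith
    have h1 := this _ (three_le_hexNorm hn)
    have h3 : (8 : ℝ) * hexNorm n ^ 2 ≤ 9 * 2 ^ hexNorm n := by exact_mod_cast h1
    rw [hM]; linarith
  have hQpow : Q = exp (-(X / y)) ^ hexNorm n := by
    rw [hQ, hM, ← exp_nat_mul, mul_comm]
  calc _ ≤ Q * (0.74 * D * (M ^ 2 / 3) + (4 * D * M ^ 2 + 8 / 9 * D * (M ^ 2 / 3))) :=
        hbound.trans (mul_le_mul_of_nonneg_left (add_le_add hfirst hsecond) hQ0)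
    _ ≤ 4.55 * D * Q * M ^ 2 := by
        have : 0 ≤ D * Q * M ^ 2 := by positivity
        linarith
    _ ≤ 4.55 * D * Q * (9 / 8 * 2 ^ hexNorm n) := by gcongr
    _ ≤ _ := by
        rw [mul_pow, ← hQpow, mul_assoc 5.12, ← hD]
        have : 0 ≤ D * Q * 2 ^ hexNorm n := by positivity
        linarith

/-- The phase `2 * sin (π / (8 * y ^ 2))` decreases linearly away from the hexagonal point. -/
lemma one_sub_two_mul_sin_bounds {y y₀ : ℝ} (h0 : 0 < y₀) (h2 : y₀ ^ 2 = 3 / 4) (hy : y₀ ≤ y)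
    (hy' : y ≤ 11 / 10) :
    1.47 * (y - y₀) ≤ 1 - 2 * sin (π / (8 * y ^ 2)) ∧
      1 - 2 * sin (π / (8 * y ^ 2)) ≤ 2.42 * (y - y₀) := by
  have hπ := pi_gt_d4
  have hπ' := pi_lt_d4
  have hy0 : 0 < y := h0.trans_le hy
  have hy₀' : 0.866 ≤ y₀ := by nlinarith
  have hh : 0 ≤ y - y₀ := sub_nonneg.2 hy
  have hy₀ : y₀ = √3 / 2 := by
    have : (2 * y₀) ^ 2 = 3 := by linarith
    rw [← this, sqrt_sq (by positivity)]
    ring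
  obtain ⟨e, he⟩ : ∃ e, e = π * (y - y₀) / 6 * ((y + y₀) / y ^ 2) := ⟨_, rfl⟩
  have hs : π / (8 * y ^ 2) = π / 6 - e := by
    have : (y - y₀) * (y + y₀) = y ^ 2 - 3 / 4 := by rw [← h2]; ring
    have : e = π / 6 * ((y ^ 2 - 3 / 4) / y ^ 2) := by rw [he, ← this]; ring
    rw [this]
    field_simp
    ring
  have he0 : 0 ≤ e := he ▸ by positivity
  have hup : e ≤ 1.21 * (y - y₀) := by
    have h1 : (y + y₀) / y ^ 2 ≤ 2.31 := by
      rw [div_le_iff₀ (by positivity)]; nlinarith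
    calc e ≤ 3.1416 * (y - y₀) / 6 * 2.31 := by rw [he]; gcongr
      _ ≤ _ := by linarith
  have hlow : 0.85 * (y - y₀) ≤ e := by
    have h1 : 1.624 ≤ (y + y₀) / y ^ 2 := by
      rw [le_div_iff₀ (by positivity)]; nlinarith
    calc _ ≤ 3.1415 * (y - y₀) / 6 * 1.624 := by linarith
      _ ≤ e := by rw [he]; gcongr
  have hval : 1 - 2 * sin (π / 6 - e) = 1 - cos e + 2 * y₀ * sin e := by
    rw [sin_sub, sin_pi_div_six, cos_pi_div_six, hy₀]; ring
  rw [hs]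
  constructor
  · rw [hval]
    rcases he0.eq_or_lt with h | h
    · rw [← h] at hlow ⊢
      simp
      linarith
    have he1 : e ≤ 0.284 := by linarith
    have hcos : 0.2 * e ^ 2 ≤ 1 - cos e := by
      have h1 := cos_le_one_sub_mul_cos_sq (x := e) (by rw [abs_of_pos h]; linarith)
      have h3 : 0.2 ≤ 2 / π ^ 2 := by
        rw [le_div_iff₀ (by positivity)]; nlinarith
      nlinarith [mul_le_mul_of_nonneg_right h3 (sq_nonneg e)]
    have hsin : e - e ^ 3 / 4 ≤ sin e := by
      linarith [sin_gt_sub_cube h, pow_pos h 3]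
    have h3 : 1.732 * (e - e ^ 3 / 4) ≤ 2 * y₀ * sin e := by
      have h4 : 0 ≤ e - e ^ 3 / 4 := by nlinarith
      have : (1.732 : ℝ) ≤ 2 * y₀ := by linarith
      gcongr
    have h5 : 1.732 * e ^ 3 / 4 ≤ 0.2 * e ^ 2 := by
      nlinarith [mul_le_mul_of_nonneg_right he1 (sq_nonneg e), sq_nonneg e]
    linarith
  · have h1 := abs_sin_sub_sin_le (π / 6) (π / 6 - e)
    rw [sub_sub_cancel, abs_of_nonneg he0, sin_pi_div_six] at h1
    linarith [(le_abs_self _).trans h1]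

/-- Polynomial inequalities for the weights of the nearest orbit. -/
lemma weight_bounds {y₀ h u D : ℝ} (h0 : 0 < y₀) (hy₀ : y₀ ≤ 0.8661) (hh0 : 0 ≤ h)
    (hh1 : h ≤ 0.234) (hD : D = 3 / 4 + y₀ * h) (hw : 1.47 * h ≤ u) (hw' : u ≤ 2.42 * h) :
    0.85 * D ^ 2 ≤ 1 - (1 - u) ^ 2 / 2 ∧
      1.4 * h * D ≤ (1 - (1 - u) ^ 2 / 2) - (1 - u) * (D - 1 / 4) := by
  have hu : u ≤ 0.57 := by linarith
  constructor
  · have h3 : 1 / 2 + 1.47 * h - (1.47 * h) ^ 2 / 2 ≤ 1 - (1 - u) ^ 2 / 2 := by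
      have : 0 ≤ (u - 1.47 * h) * (2 - u - 1.47 * h) :=
        mul_nonneg (by linarith) (by linarith)
      linarith
    have h4 : D ≤ 3 / 4 + 0.8661 * h := by rw [hD]; gcongr
    have h5 : 0 ≤ D := by rw [hD]; positivity
    have h6 : D ^ 2 ≤ (3 / 4 + 0.8661 * h) ^ 2 := by gcongr
    have h7 : 0 ≤ h * (0.234 - h) := mul_nonneg hh0 (by linarith)
    linarith
  · rw [hD]
    have h3 : 0 ≤ (u - 1.47 * h) * (1.5 - (u + 1.47 * h) / 2) :=
      mul_nonneg (by linarith) (by linarith)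
    have h4 : 0 ≤ (u - 1.47 * h) * (y₀ * h) :=
      mul_nonneg (by linarith) (mul_nonneg h0.le hh0)
    have h5 : 0 ≤ y₀ * h ^ 2 := by positivity
    have h6 : 0 ≤ h * (0.8661 - y₀) := mul_nonneg hh0 (by linarith)
    have h7 : 0 ≤ h * (0.234 - h) := mul_nonneg hh0 (by linarith)
    linarith

/-- The nearest orbit, divided by its value at the hexagonal point, grows quadratically. -/
lemma weighted_exp_ge {X y y₀ w : ℝ} (hX : π ≤ X) (h0 : 0 < y₀) (h2 : y₀ ^ 2 = 3 / 4)
    (hy : y₀ ≤ y) (hy' : y ≤ 11 / 10) (hw : 1.47 * (y - y₀) ≤ 1 - w)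
    (hw' : 1 - w ≤ 2.42 * (y - y₀)) :
    3 / 2 + 0.425 * X ^ 2 * (y - y₀) ^ 2 ≤
      (1 - w ^ 2 / 2) * exp (X * ((y - y₀) / (y * y₀))) +
        w * exp (-(X * ((y - y₀) * (1 - 1 / (y * y₀) / 4)))) := by
  have hπ := pi_gt_d4
  have hX0 : 0 < X := by linarith
  have hy0 : 0 < y := h0.trans_le hy
  have hy₀l : 0.866 ≤ y₀ := by nlinarith
  have hy₀u : y₀ ≤ 0.8661 := by nlinarith
  obtain ⟨h, hh⟩ : ∃ h, h = y - y₀ := ⟨_, rfl⟩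
  rw [← hh] at hw hw' ⊢
  have hh0 : 0 ≤ h := hh ▸ sub_nonneg.2 hy
  have hh1 : h ≤ 0.234 := by linarith
  obtain ⟨u, hu⟩ : ∃ u, u = 1 - w := ⟨_, rfl⟩
  rw [← hu] at hw hw'
  obtain rfl : w = 1 - u := by linarith
  obtain ⟨D, hD⟩ : ∃ D, D = y * y₀ := ⟨_, rfl⟩
  have hD0 : 0 < D := hD ▸ by positivity
  have hDh : D = 3 / 4 + y₀ * h := by rw [hD, hh, ← h2]; ring
  rw [← hD]
  obtain ⟨hw1, hlin⟩ := weight_bounds h0 hy₀u hh0 hh1 hDh hw hw'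
  have hw10 : 0 ≤ 1 - (1 - u) ^ 2 / 2 := le_trans (by positivity) hw1
  have hw0 : 0 ≤ 1 - u := by linarith
  have hE := quadratic_le_exp_of_nonneg (x := X * (h / D)) (by positivity)
  have hE' := add_one_le_exp (-(X * (h * (1 - 1 / D / 4))))
  have hsq : 0.425 * X ^ 2 * h ^ 2 ≤ (1 - (1 - u) ^ 2 / 2) * ((X * (h / D)) ^ 2 / 2) := by
    calc _ = 0.85 * D ^ 2 * ((X * (h / D)) ^ 2 / 2) := by field_simp; ring
      _ ≤ _ := by gcongr
  have hfirst : 1.4 * X * h ^ 2 ≤ (1 - (1 - u) ^ 2 / 2) * (X * (h / D)) -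
      (1 - u) * (X * (h * (1 - 1 / D / 4))) := by
    calc _ = X * (h / D) * (1.4 * h * D) := by field_simp
      _ ≤ X * (h / D) * ((1 - (1 - u) ^ 2 / 2) - (1 - u) * (D - 1 / 4)) := by gcongr
      _ = _ := by field_simp
  have hzero : -(2.93 * h ^ 2) ≤ -(u ^ 2 / 2) := by nlinarith
  have hXh : 2.93 * h ^ 2 ≤ 1.4 * X * h ^ 2 := by
    have : 2.93 ≤ 1.4 * X := by linarith
    gcongr
  linarith [mul_le_mul_of_nonneg_left hE hw10, mul_le_mul_of_nonneg_left hE' hw0]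

/-- The nearest orbit gains quadratically at the hexagonal point. -/
lemma orbitSum_zero_sub_le {X y y₀ : ℝ} (hX : π ≤ X) (h0 : 0 < y₀) (h2 : y₀ ^ 2 = 3 / 4)
    (hy : y₀ ≤ y) (hy' : y ≤ 11 / 10) :
    orbitSum (chargedTerm X y) 0 - orbitSum (chargedTerm X y₀) 0 ≤
      -(0.425 * X ^ 2 * (y - y₀) ^ 2 * exp (-(X / y₀))) := by
  have hy0 : 0 < y := h0.trans_le hy
  obtain ⟨hw, hw'⟩ := one_sub_two_mul_sin_bounds h0 h2 hy hy'
  have key := weighted_exp_ge hX h0 h2 hy hy' hw hw'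
  have h3 : y₀ + 1 / (4 * y₀) = 1 / y₀ := by field_simp; linarith
  have h4 : π / (8 * y₀ ^ 2) = π / 6 := by rw [h2]; ring
  have hq : exp (-(X / y)) = exp (-(X / y₀)) * exp (X * ((y - y₀) / (y * y₀))) := by
    rw [← exp_add]; congr 1; field_simp; ring
  have hq' : exp (-(X * (y + 1 / (4 * y)))) =
      exp (-(X / y₀)) * exp (-(X * ((y - y₀) * (1 - 1 / (y * y₀) / 4)))) := by
    rw [← exp_add]
    congr 1
    field_simp
    linear_combination (-(4 * X * y)) * h2
  rw [orbitSum_zero hy0, orbitSum_zero h0, h3, h4, sin_pi_div_six, hq, hq', mul_one_div]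
  linarith [mul_le_mul_of_nonneg_left key (exp_pos (-(X / y₀))).le]

/-- A numerical lower bound for the exponential near the integer `n`. -/
lemma mul_pow_le_exp (n : ℕ) (x : ℝ) (hx : (n : ℝ) - 1 ≤ x) :
    (x - n + 1) * 2.718 ^ n ≤ exp x := by
  calc _ ≤ exp (x - n) * exp 1 ^ n := by
        have h1 := add_one_le_exp (x - n)
        have h2 : (2.718 : ℝ) ≤ exp 1 := by linarith [exp_one_gt_d9]
        have h3 : 0 ≤ x - n + 1 := by linarith
        gcongr
    _ = exp x := by rw [← exp_nat_mul, ← exp_add]; congr 1; ring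

/-- Near the hexagonal point, the gain of the nearest orbit outweighs all the other orbits. -/
lemma gTheta_le_hexagonal_of_near {α y y₀ : ℝ} (hα : 1 ≤ α) (h0 : 0 < y₀) (h2 : y₀ ^ 2 = 3 / 4)
    (hy : y₀ ≤ y) (hy' : y ≤ 11 / 10) : gTheta α y ≤ gTheta α y₀ := by
  have hπ := pi_gt_d4
  have hy0 : 0 < y := h0.trans_le hy
  have hy₀u : y₀ ≤ 0.8661 := by nlinarith
  have hy2 : 3 / 4 ≤ y ^ 2 := by nlinarith
  obtain ⟨hs, ht⟩ := gTheta_eq_orbitSum (one_pos.trans_le hα) hy0 hy2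
  obtain ⟨hs₀, ht₀⟩ := gTheta_eq_orbitSum (one_pos.trans_le hα) h0 h2.ge
  rw [ht, ht₀]
  have hX : π ≤ π * α := le_mul_of_one_le_right pi_pos.le hα
  clear ht ht₀
  generalize π * α = X at hs hs₀ hX ⊢
  have hX0 : 0 < X := by linarith
  have hdec : 2.855 ≤ X / y := by rw [le_div_iff₀ hy0]; linarith
  obtain ⟨q, hq⟩ : ∃ q, q = exp (-(X / y)) := ⟨_, rfl⟩
  have hq0 : 0 < q := hq ▸ exp_pos _
  have hq1 : q ≤ 1 / 17 := by
    have h1 : (17 : ℝ) ≤ exp 2.855 := le_trans (by norm_num) (mul_pow_le_exp 3 2.855 (by norm_num))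
    rw [hq, exp_neg, ← one_div]
    exact one_div_le_one_div_of_le (by norm_num) (h1.trans (exp_le_exp.2 hdec))
  have hqρ : 132 * q ^ 3 ≤ exp (-(X / y₀)) := by
    have h1 : (132 : ℝ) ≤ exp 4.9 := le_trans (by norm_num) (mul_pow_le_exp 5 4.9 (by norm_num))
    have h3 : 4.9 ≤ 3 * (X / y) - X / y₀ := by
      have : 1.56 ≤ 3 / y - 1 / y₀ := by
        rw [div_sub_div _ _ hy0.ne' h0.ne', le_div_iff₀ (by positivity)]
        nlinarith
      calc 4.9 ≤ 3.1415 * 1.56 := by norm_num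
        _ ≤ X * (3 / y - 1 / y₀) := by gcongr; linarith
        _ = _ := by ring
    calc 132 * q ^ 3 ≤ exp 4.9 * q ^ 3 := by gcongr
      _ = exp (4.9 + 3 * (-(X / y))) := by rw [exp_add, hq, ← exp_nat_mul]; norm_num
      _ ≤ _ := exp_le_exp.2 (by linarith)
  have hmain := tsum_le_of_le_mul_pow_hexNorm (hs.sub hs₀) (C := 5.12 * X ^ 2 * (y - y₀) ^ 2)
    (z := 2 * q) (by positivity) (by positivity) (by linarith)
    (fun n hn => hq ▸ orbitSum_sub_le hX h0 h2 hy hn)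
  rw [hs.tsum_sub hs₀] at hmain
  have htail : 2 * q / ((1 - (2 * q) ^ 2) * (1 - (2 * q) ^ 3)) - 2 * q ≤
      1.14 * (2 * q) ^ 2 * (2 * q) := by
    obtain ⟨z, hz⟩ : ∃ z, z = 2 * q := ⟨_, rfl⟩
    rw [← hz]
    have hz0 : 0 ≤ z := by rw [hz]; positivity
    have hz1 : z ≤ 2 / 17 := by linarith
    refine sector_tail_le hz0 le_rfl (by linarith) ?_ (by positivity)
    have h1 : z ^ 2 ≤ 4 / 289 := by nlinarith
    nlinarith [mul_nonneg (sq_nonneg z) (sub_nonneg.2 hz1),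
      mul_nonneg (sq_nonneg z) (sub_nonneg.2 h1), pow_nonneg hz0 5, pow_nonneg hz0 7]
  have hgain := orbitSum_zero_sub_le hX h0 h2 hy hy'
  obtain ⟨D, hD⟩ : ∃ D, D = X ^ 2 * (y - y₀) ^ 2 := ⟨_, rfl⟩
  have hD0 : 0 ≤ D := hD ▸ by positivity
  rw [mul_assoc _ (X ^ 2), ← hD] at hmain hgain
  have h5 := mul_le_mul_of_nonneg_left htail hD0
  have h6 := mul_le_mul_of_nonneg_left hqρ hD0
  have h7 : 0 ≤ D * exp (-(X / y₀)) := mul_nonneg hD0 (exp_pos _).le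
  linarith

/-- For every `α ≥ 1`, `g_α` attains its maximum over `[√3/2, ∞)` at `y = √3/2`. -/
theorem gTheta_max (α : ℝ) (hα : 1 ≤ α) (y : ℝ) (hy : Real.sqrt 3 / 2 ≤ y) :
    gTheta α y ≤ gTheta α (Real.sqrt 3 / 2) := by
  have h0 : 0 < √3 / 2 := by positivity
  have h2 : (√3 / 2) ^ 2 = 3 / 4 := by rw [div_pow, sq_sqrt (by norm_num)]; norm_num
  rcases le_total y (11 / 10) with h | h
  · exact gTheta_le_hexagonal_of_near hα h0 h2 hy h
  · exact gTheta_le_hexagonal_of_far hα h0 h2 h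
end

section
/- For every fixed α > 0, the partial derivatives with respect to x and with respect to y of the function (x,y) ↦ θ_{x,y}(b(x,y);α) both vanish at (x,y) = (1/2, √3/2); the same holds for (x,y) ↦ θ̂_{x,y}(b(x,y);α). Thus the hexagonal lattice is a critical point of both functions in the space of lattices. -/
/-- The shifted lattice theta function `θ_{x,y}(z;α)`. -/
noncomputable def latticeTheta (x y : ℝ) (z : ℝ × ℝ) (α : ℝ) : ℝ :=
  ∑' p : ℤ × ℤ,
    Real.exp (-(Real.pi * α / y) *
      (((p.1 : ℝ) + z.1) ^ 2 + 2 * x * ((p.1 : ℝ) + z.1) * ((p.2 : ℝ) + z.2) +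
        (x ^ 2 + y ^ 2) * ((p.2 : ℝ) + z.2) ^ 2))

/-- The charged (dual) lattice theta function `θ̂_{x,y}(z;α)`. -/
noncomputable def latticeThetaHat (x y : ℝ) (z : ℝ × ℝ) (α : ℝ) : ℝ :=
  ∑' p : ℤ × ℤ,
    Real.exp (-(Real.pi * α / y) *
      ((p.1 : ℝ) ^ 2 + 2 * x * (p.1 : ℝ) * (p.2 : ℝ) + (x ^ 2 + y ^ 2) * (p.2 : ℝ) ^ 2)) *
    Real.cos (2 * Real.pi * ((p.1 : ℝ) * z.2 - (p.2 : ℝ) * z.1))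

/-- The special shift `b(x,y)`. -/
noncomputable def bPoint (x y : ℝ) : ℝ × ℝ :=
  ((x + (1 - x) * 4 * y ^ 2) / (8 * y ^ 2), (4 * y ^ 2 - 1) / (8 * y ^ 2))

lemma summable_exp_neg_mul_int_sq {d : ℝ} (hd : 0 < d) :
    Summable fun n : ℤ => Real.exp (-(d * (n : ℝ) ^ 2)) := by
  have hnat : Summable fun n : ℕ => Real.exp (-(d * (n : ℝ) ^ 2)) := by
    refine Summable.of_nonneg_of_le (fun _ => (Real.exp_pos _).le) (fun n => ?_)
      (Real.summable_exp_nat_mul_iff.2 (neg_lt_zero.2 hd))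
    have hn : (n : ℝ) ≤ (n : ℝ) ^ 2 := by exact_mod_cast Nat.le_self_pow two_ne_zero n
    exact Real.exp_le_exp.2 (by nlinarith)
  exact Summable.of_nat_of_neg (by simpa using hnat) (by simpa using hnat)

lemma summable_exp_neg_mul_sq_add_sq {d : ℝ} (hd : 0 < d) :
    Summable fun p : ℤ × ℤ => Real.exp (-(d * ((p.1 : ℝ) ^ 2 + (p.2 : ℝ) ^ 2))) := by
  refine ((summable_exp_neg_mul_int_sq hd).mul_of_nonneg (summable_exp_neg_mul_int_sq hd)
    (fun _ => (Real.exp_pos _).le) (fun _ => (Real.exp_pos _).le)).congr (fun p => ?_)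
  rw [← Real.exp_add]
  ring_nf

lemma mul_exp_neg_le {c : ℝ} (hc : 0 < c) (w : ℝ) :
    w * Real.exp (-(c * w)) ≤ 2 / c * Real.exp (-(c * w / 2)) := by
  have h : c * w / 2 ≤ Real.exp (c * w / 2) := by linarith [Real.add_one_le_exp (c * w / 2)]
  have hw : w ≤ 2 / c * Real.exp (c * w / 2) := by
    rw [div_mul_eq_mul_div, le_div_iff₀ hc]
    linarith
  calc w * Real.exp (-(c * w)) ≤ 2 / c * Real.exp (c * w / 2) * Real.exp (-(c * w)) := by gcongr
    _ = 2 / c * Real.exp (-(c * w / 2)) := by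
      rw [mul_assoc, ← Real.exp_add]
      ring_nf

lemma mul_sq_add_sq_le_quadratic {a b d c u v : ℝ} (h1 : c < a)
    (h2 : b ^ 2 < (a - c) * (d - c)) :
    c * (u ^ 2 + v ^ 2) ≤ a * u ^ 2 + 2 * b * u * v + d * v ^ 2 := by
  have h : 0 ≤ (a - c) * (a * u ^ 2 + 2 * b * u * v + d * v ^ 2 - c * (u ^ 2 + v ^ 2)) := by
    nlinarith [sq_nonneg ((a - c) * u + b * v), mul_nonneg (sub_pos.2 h2).le (sq_nonneg v)]
  linarith [nonneg_of_mul_nonneg_right h (sub_pos.2 h1)]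

lemma ContDiffAt.eventually_hasDerivAt_and_bounded {f : ℝ → ℝ} {t₀ : ℝ}
    (hf : ContDiffAt ℝ 1 f t₀) :
    ∀ᶠ M in Filter.atTop, ∀ᶠ t in nhds t₀,
      HasDerivAt f (deriv f t) t ∧ |f t| ≤ M ∧ |deriv f t| ≤ M := by
  filter_upwards [Filter.eventually_gt_atTop |f t₀|, Filter.eventually_gt_atTop |deriv f t₀|]
    with M h0 h1
  have hd : ContinuousAt (deriv f) t₀ := (hf.derivWithin (m := 0) (by norm_num)).continuousAt
  filter_upwards [hf.eventually (by simp), hf.continuousAt.abs.eventually_lt_const h0,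
    hd.abs.eventually_lt_const h1] with t h2 h3 h4
  exact ⟨(h2.differentiableAt one_ne_zero).hasDerivAt, h3.le, h4.le⟩

/-- The energy `a u² + 2 b u v + d v²` at the lattice point `p` shifted by `(z₁, z₂)`. -/
def shiftedEnergy (a b d z₁ z₂ : ℝ) (p : ℤ × ℤ) : ℝ :=
  a * (p.1 + z₁) ^ 2 + 2 * b * (p.1 + z₁) * (p.2 + z₂) + d * (p.2 + z₂) ^ 2

/-- The derivative of `shiftedEnergy` in the direction `(a', b', d', z₁', z₂')`. -/
def shiftedEnergyDeriv (a b d z₁ z₂ a' b' d' z₁' z₂' : ℝ) (p : ℤ × ℤ) : ℝ :=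
  a' * (p.1 + z₁) ^ 2 + 2 * b' * (p.1 + z₁) * (p.2 + z₂) + d' * (p.2 + z₂) ^ 2 +
    2 * a * (p.1 + z₁) * z₁' + 2 * b * (z₁' * (p.2 + z₂) + (p.1 + z₁) * z₂') +
    2 * d * (p.2 + z₂) * z₂'

lemma hasDerivAt_shiftedEnergy {A B D Z₁ Z₂ : ℝ → ℝ} {a' b' d' z₁' z₂' t : ℝ}
    (hA : HasDerivAt A a' t) (hB : HasDerivAt B b' t) (hD : HasDerivAt D d' t)
    (hZ₁ : HasDerivAt Z₁ z₁' t) (hZ₂ : HasDerivAt Z₂ z₂' t) (p : ℤ × ℤ) :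
    HasDerivAt (fun t => shiftedEnergy (A t) (B t) (D t) (Z₁ t) (Z₂ t) p)
      (shiftedEnergyDeriv (A t) (B t) (D t) (Z₁ t) (Z₂ t) a' b' d' z₁' z₂' p) t := by
  have hu := hZ₁.const_add (p.1 : ℝ)
  have hv := hZ₂.const_add (p.2 : ℝ)
  have h := ((hA.mul (hu.pow 2)).add (((hB.const_mul 2).mul hu).mul hv)).add (hD.mul (hv.pow 2))
  refine h.congr_deriv ?_
  simp only [shiftedEnergyDeriv, Pi.mul_apply, Pi.pow_apply]
  ring

lemma abs_shiftedEnergyDeriv_le {a b d z₁ z₂ a' b' d' z₁' z₂' M : ℝ} (ha : |a| ≤ M)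
    (hb : |b| ≤ M) (hd : |d| ≤ M) (ha' : |a'| ≤ M) (hb' : |b'| ≤ M) (hd' : |d'| ≤ M)
    (hz₁' : |z₁'| ≤ M) (hz₂' : |z₂'| ≤ M) (p : ℤ × ℤ) :
    |shiftedEnergyDeriv a b d z₁ z₂ a' b' d' z₁' z₂' p| ≤
      (2 * M + 4 * M ^ 2) * ((p.1 + z₁) ^ 2 + (p.2 + z₂) ^ 2 + 1) := by
  have hM : 0 ≤ M := (abs_nonneg _).trans ha
  unfold shiftedEnergyDeriv
  generalize (p.1 : ℝ) + z₁ = u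
  generalize (p.2 : ℝ) + z₂ = v
  have key : |a' * u ^ 2 + 2 * b' * u * v + d' * v ^ 2 + 2 * a * u * z₁' +
      2 * b * (z₁' * v + u * z₂') + 2 * d * v * z₂'| ≤
      M * |u| ^ 2 + 2 * M * |u| * |v| + M * |v| ^ 2 + 2 * M * |u| * M +
      2 * M * (M * |v| + |u| * M) + 2 * M * |v| * M := by
    refine (abs_add_le _ _).trans (add_le_add ((abs_add_le _ _).trans (add_le_add
      ((abs_add_le _ _).trans (add_le_add ((abs_add_le _ _).trans (add_le_add
      ((abs_add_le _ _).trans (add_le_add ?_ ?_)) ?_)) ?_)) ?_)) ?_)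
    · rw [abs_mul, abs_pow]; gcongr
    · rw [abs_mul, abs_mul, abs_mul, abs_two]; gcongr
    · rw [abs_mul, abs_pow]; gcongr
    · rw [abs_mul, abs_mul, abs_mul, abs_two]; gcongr
    · rw [abs_mul, abs_mul, abs_two]
      gcongr
      refine (abs_add_le _ _).trans (add_le_add ?_ ?_)
      · rw [abs_mul]; gcongr
      · rw [abs_mul]; gcongr
    · rw [abs_mul, abs_mul, abs_mul, abs_two]; gcongr
  refine key.trans ?_
  rw [← sq_abs u, ← sq_abs v]
  generalize |u| = x
  generalize |v| = y
  nlinarith [mul_nonneg hM (sq_nonneg (x - y)), mul_nonneg hM (sq_nonneg (x + y)),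
    mul_nonneg (sq_nonneg M) (sq_nonneg (2 * x - 1)),
    mul_nonneg (sq_nonneg M) (sq_nonneg (2 * y - 1)), sq_nonneg M]

lemma abs_phase_le {w₁ w₂ z₁ z₂ M : ℝ} (hw₁ : |w₁| ≤ M) (hw₂ : |w₂| ≤ M) (hz₁ : |z₁| ≤ M)
    (hz₂ : |z₂| ≤ M) (p : ℤ × ℤ) :
    |p.1 * w₁ + p.2 * w₂| ≤ (M + 2 * M ^ 2) * ((p.1 + z₁) ^ 2 + (p.2 + z₂) ^ 2 + 1) := by
  have hM : 0 ≤ M := (abs_nonneg _).trans hw₁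
  have hk : |(p.1 : ℝ)| ≤ |p.1 + z₁| + M := by
    have := abs_sub (p.1 + z₁) z₁
    rw [add_sub_cancel_right] at this
    linarith
  have hl : |(p.2 : ℝ)| ≤ |p.2 + z₂| + M := by
    have := abs_sub (p.2 + z₂) z₂
    rw [add_sub_cancel_right] at this
    linarith
  have h : |p.1 * w₁ + p.2 * w₂| ≤ (|p.1 + z₁| + M) * M + (|p.2 + z₂| + M) * M := by
    refine (abs_add_le _ _).trans (add_le_add ?_ ?_) <;> rw [abs_mul] <;> gcongr
  refine h.trans ?_
  rw [← sq_abs (p.1 + z₁), ← sq_abs (p.2 + z₂)]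
  generalize |p.1 + z₁| = x
  generalize |p.2 + z₂| = y
  nlinarith [mul_nonneg hM (sq_nonneg (2 * x - 1)), mul_nonneg hM (sq_nonneg (2 * y - 1)),
    mul_nonneg (sq_nonneg M) (sq_nonneg x), mul_nonneg (sq_nonneg M) (sq_nonneg y)]

lemma neg_shifted_sq_le {c z₁ z₂ M : ℝ} (hc : 0 < c) (hz₁ : |z₁| ≤ M) (hz₂ : |z₂| ≤ M)
    (p : ℤ × ℤ) :
    -(c * ((p.1 + z₁) ^ 2 + (p.2 + z₂) ^ 2)) ≤
      2 * c * M ^ 2 + -(c / 2 * ((p.1 : ℝ) ^ 2 + (p.2 : ℝ) ^ 2)) := by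
  have h1 : z₁ ^ 2 ≤ M ^ 2 := sq_le_sq.2 (hz₁.trans (le_abs_self M))
  have h2 : z₂ ^ 2 ≤ M ^ 2 := sq_le_sq.2 (hz₂.trans (le_abs_self M))
  nlinarith [mul_nonneg hc.le (sq_nonneg ((p.1 : ℝ) + 2 * z₁)),
    mul_nonneg hc.le (sq_nonneg ((p.2 : ℝ) + 2 * z₂)), mul_le_mul_of_nonneg_left h1 hc.le,
    mul_le_mul_of_nonneg_left h2 hc.le]

/-- Termwise differentiation of shifted and charged theta series along a `C¹` curve of
positive definite forms, shifts and charges. -/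
theorem hasDerivAt_tsum_exp_shiftedEnergy_mul_cos {A B D Z₁ Z₂ W₁ W₂ : ℝ → ℝ} {t₀ : ℝ}
    (hA : ContDiffAt ℝ 1 A t₀) (hB : ContDiffAt ℝ 1 B t₀) (hD : ContDiffAt ℝ 1 D t₀)
    (hZ₁ : ContDiffAt ℝ 1 Z₁ t₀) (hZ₂ : ContDiffAt ℝ 1 Z₂ t₀)
    (hW₁ : ContDiffAt ℝ 1 W₁ t₀) (hW₂ : ContDiffAt ℝ 1 W₂ t₀) {c : ℝ} (hc : 0 < c)
    (hcA : c < A t₀) (hcB : B t₀ ^ 2 < (A t₀ - c) * (D t₀ - c)) :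
    HasDerivAt (fun t => ∑' p : ℤ × ℤ,
        Real.exp (-shiftedEnergy (A t) (B t) (D t) (Z₁ t) (Z₂ t) p) *
          Real.cos (p.1 * W₁ t + p.2 * W₂ t))
      (∑' p : ℤ × ℤ, -(Real.exp (-shiftedEnergy (A t₀) (B t₀) (D t₀) (Z₁ t₀) (Z₂ t₀) p) *
        (shiftedEnergyDeriv (A t₀) (B t₀) (D t₀) (Z₁ t₀) (Z₂ t₀) (deriv A t₀) (deriv B t₀)
            (deriv D t₀) (deriv Z₁ t₀) (deriv Z₂ t₀) p * Real.cos (p.1 * W₁ t₀ + p.2 * W₂ t₀) +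
          (p.1 * deriv W₁ t₀ + p.2 * deriv W₂ t₀) * Real.sin (p.1 * W₁ t₀ + p.2 * W₂ t₀)))) t₀ := by
  obtain ⟨M, eA, eB, eD, eZ₁, eZ₂, eW₁, eW₂⟩ :=
    (hA.eventually_hasDerivAt_and_bounded.and (hB.eventually_hasDerivAt_and_bounded.and
      (hD.eventually_hasDerivAt_and_bounded.and (hZ₁.eventually_hasDerivAt_and_bounded.and
      (hZ₂.eventually_hasDerivAt_and_bounded.and (hW₁.eventually_hasDerivAt_and_bounded.and
      hW₂.eventually_hasDerivAt_and_bounded)))))).exists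
  have eP : ∀ᶠ t in nhds t₀, c < A t ∧ B t ^ 2 < (A t - c) * (D t - c) :=
    (hA.continuousAt.eventually_const_lt hcA).and
      ((hB.continuousAt.pow 2).eventually_lt ((hA.continuousAt.sub continuousAt_const).mul
        (hD.continuousAt.sub continuousAt_const)) hcB)
  obtain ⟨ε, hε, hball⟩ := Metric.eventually_nhds_iff_ball.1
    (eA.and (eB.and (eD.and (eZ₁.and (eZ₂.and (eW₁.and (eW₂.and eP)))))))
  have ht₀ : t₀ ∈ Metric.ball t₀ ε := Metric.mem_ball_self hε
  have hM : 0 ≤ M := (abs_nonneg _).trans (hball t₀ ht₀).1.2.1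
  have hexp : ∀ d : ℝ, 0 < d → ∀ t ∈ Metric.ball t₀ ε, ∀ p : ℤ × ℤ,
      Real.exp (-(d * ((p.1 + Z₁ t) ^ 2 + (p.2 + Z₂ t) ^ 2))) ≤ Real.exp (2 * d * M ^ 2) *
        Real.exp (-(d / 2 * ((p.1 : ℝ) ^ 2 + (p.2 : ℝ) ^ 2))) := by
    intro d hd t ht p
    obtain ⟨-, -, -, hz₁, hz₂, -⟩ := hball t ht
    rw [← Real.exp_add]
    exact Real.exp_le_exp.2 (neg_shifted_sq_le hd hz₁.2.1 hz₂.2.1 p)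
  have henergy : ∀ t ∈ Metric.ball t₀ ε, ∀ p : ℤ × ℤ,
      Real.exp (-shiftedEnergy (A t) (B t) (D t) (Z₁ t) (Z₂ t) p) ≤
        Real.exp (-(c * ((p.1 + Z₁ t) ^ 2 + (p.2 + Z₂ t) ^ 2))) := by
    intro t ht p
    obtain ⟨-, -, -, -, -, -, -, h1, h2⟩ := hball t ht
    exact Real.exp_le_exp.2 (neg_le_neg (mul_sq_add_sq_le_quadratic h1 h2))
  refine hasDerivAt_tsum_of_isPreconnected (t := Metric.ball t₀ ε) (y₀ := t₀)
    (u := fun p : ℤ × ℤ => (3 * M + 6 * M ^ 2) * (2 / c * (Real.exp (c / 2) *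
      (Real.exp (2 * (c / 2) * M ^ 2) *
        Real.exp (-(c / 2 / 2 * ((p.1 : ℝ) ^ 2 + (p.2 : ℝ) ^ 2)))))))
    (g' := fun p t => -(Real.exp (-shiftedEnergy (A t) (B t) (D t) (Z₁ t) (Z₂ t) p) *
        (shiftedEnergyDeriv (A t) (B t) (D t) (Z₁ t) (Z₂ t) (deriv A t) (deriv B t)
            (deriv D t) (deriv Z₁ t) (deriv Z₂ t) p * Real.cos (p.1 * W₁ t + p.2 * W₂ t) +
          (p.1 * deriv W₁ t + p.2 * deriv W₂ t) * Real.sin (p.1 * W₁ t + p.2 * W₂ t))))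
    ?_ Metric.isOpen_ball (convex_ball t₀ ε).isPreconnected ?_ ?_ ht₀ ?_ ht₀
  · exact ((((summable_exp_neg_mul_sq_add_sq (by positivity)).mul_left _).mul_left _).mul_left
      _).mul_left _
  · intro p t ht
    obtain ⟨hA, hB, hD, hZ₁, hZ₂, hW₁, hW₂, -⟩ := hball t ht
    have hE := (hasDerivAt_shiftedEnergy hA.1 hB.1 hD.1 hZ₁.1 hZ₂.1 p).fun_neg.exp
    have hφ := ((hW₁.1.const_mul (p.1 : ℝ)).fun_add (hW₂.1.const_mul (p.2 : ℝ))).cos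
    exact (hE.fun_mul hφ).congr_deriv (by ring)
  · intro p t ht
    obtain ⟨hA, hB, hD, hZ₁, hZ₂, hW₁, hW₂, -⟩ := hball t ht
    have h1 := abs_shiftedEnergyDeriv_le (z₁ := Z₁ t) (z₂ := Z₂ t) hA.2.1 hB.2.1 hD.2.1 hA.2.2
      hB.2.2 hD.2.2 hZ₁.2.2 hZ₂.2.2 p
    have h2 := abs_phase_le hW₁.2.2 hW₂.2.2 hZ₁.2.1 hZ₂.2.1 p
    have h3 := henergy t ht p
    have h4 := hexp (c / 2) (by positivity) t ht p
    set S : ℝ := (p.1 + Z₁ t) ^ 2 + (p.2 + Z₂ t) ^ 2 with hS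
    rw [norm_neg, norm_mul, Real.norm_eq_abs, Real.norm_eq_abs, Real.abs_exp]
    have h5 : ∀ e f θ : ℝ, |e * Real.cos θ + f * Real.sin θ| ≤ |e| + |f| := by
      intro e f θ
      refine (abs_add_le _ _).trans (add_le_add ?_ ?_) <;> rw [abs_mul]
      · exact mul_le_of_le_one_right (abs_nonneg _) (Real.abs_cos_le_one _)
      · exact mul_le_of_le_one_right (abs_nonneg _) (Real.abs_sin_le_one _)
    calc _ ≤ Real.exp (-(c * S)) * ((3 * M + 6 * M ^ 2) * (S + 1)) := by
          gcongr
          exact (h5 _ _ _).trans (by linarith)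
      _ = (3 * M + 6 * M ^ 2) * (Real.exp c * ((S + 1) * Real.exp (-(c * (S + 1))))) := by
          rw [show -(c * S) = c + -(c * (S + 1)) by ring, Real.exp_add]
          ring
      _ ≤ (3 * M + 6 * M ^ 2) * (Real.exp c * (2 / c * Real.exp (-(c * (S + 1) / 2)))) := by
          gcongr _ * (_ * ?_)
          exact mul_exp_neg_le hc _
      _ = (3 * M + 6 * M ^ 2) * (2 / c * (Real.exp (c / 2) * Real.exp (-(c / 2 * S)))) := by
          have : Real.exp c * Real.exp (-(c * (S + 1) / 2)) =
              Real.exp (c / 2) * Real.exp (-(c / 2 * S)) := by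
            rw [← Real.exp_add, ← Real.exp_add]
            ring_nf
          rw [← this]
          ring
      _ ≤ _ := by gcongr
  · refine Summable.of_norm_bounded
      ((summable_exp_neg_mul_sq_add_sq (half_pos hc)).mul_left (Real.exp (2 * c * M ^ 2)))
      (fun p => ?_)
    rw [norm_mul, Real.norm_eq_abs, Real.norm_eq_abs, Real.abs_exp]
    exact (mul_le_of_le_one_right (Real.exp_pos _).le (Real.abs_cos_le_one _)).trans
      ((henergy t₀ ht₀ p).trans (hexp c hc t₀ ht₀ p))

/-- Rotation of the hexagonal lattice by a third of a turn about the point with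
coordinates `(-c/3, -c/3)`. -/
def hexRotation (c : ℤ) : ℤ × ℤ ≃ ℤ × ℤ where
  toFun p := (-p.1 - p.2 - c, p.1)
  invFun p := (p.2, -p.1 - p.2 - c)
  left_inv p := by ext <;> ring
  right_inv p := by ext <;> ring

lemma tsum_eq_zero_of_orbit_sum_eq_zero {ι : Type*} (σ : ι ≃ ι) {f : ι → ℝ}
    (hf : ∀ i, f i + f (σ i) + f (σ (σ i)) = 0) : ∑' i, f i = 0 := by
  by_cases hs : Summable f
  · have hs1 : Summable fun i => f (σ i) := (σ.summable_iff (f := f)).2 hs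
    have hs2 : Summable fun i => f (σ (σ i)) := (σ.summable_iff (f := fun i => f (σ i))).2 hs1
    have h := (hs.add hs1).tsum_add hs2
    rw [hs.tsum_add hs1, σ.tsum_eq f, σ.tsum_eq (fun i => f (σ i)), σ.tsum_eq f] at h
    simp only [hf, tsum_zero] at h
    linarith
  · exact tsum_eq_zero_of_not_summable hs

/-- A theta series is stationary at a hexagonal form along every `C¹` curve whose velocity is
trace-free, provided that the shift and the charge are fixed by a third of a turn. -/
theorem hasDerivAt_tsum_zero_of_hexagonal {A B D Z₁ Z₂ W₁ W₂ : ℝ → ℝ} {t₀ : ℝ}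
    (hA : ContDiffAt ℝ 1 A t₀) (hB : ContDiffAt ℝ 1 B t₀) (hD : ContDiffAt ℝ 1 D t₀)
    (hZ₁ : ContDiffAt ℝ 1 Z₁ t₀) (hZ₂ : ContDiffAt ℝ 1 Z₂ t₀)
    (hW₁ : ContDiffAt ℝ 1 W₁ t₀) (hW₂ : ContDiffAt ℝ 1 W₂ t₀) {b : ℝ} (hb : 0 < b)
    (hA₀ : A t₀ = 2 * b) (hB₀ : B t₀ = b) (hD₀ : D t₀ = 2 * b)
    (htrace : deriv A t₀ - deriv B t₀ + deriv D t₀ = 0) {c m : ℤ} (hcm : c * m = 0)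
    (hZ₁₀ : Z₁ t₀ = c / 3) (hZ₂₀ : Z₂ t₀ = c / 3) (hW₁₀ : W₁ t₀ = m / 3 * (2 * Real.pi))
    (hW₂₀ : W₂ t₀ = -(m / 3 * (2 * Real.pi))) :
    HasDerivAt (fun t => ∑' p : ℤ × ℤ,
        Real.exp (-shiftedEnergy (A t) (B t) (D t) (Z₁ t) (Z₂ t) p) *
          Real.cos (p.1 * W₁ t + p.2 * W₂ t)) 0 t₀ := by
  refine (hasDerivAt_tsum_exp_shiftedEnergy_mul_cos hA hB hD hZ₁ hZ₂ hW₁ hW₂ (half_pos hb)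
    (by rw [hA₀]; linarith) (by rw [hA₀, hB₀, hD₀]; nlinarith)).congr_deriv ?_
  rw [hA₀, hB₀, hD₀, hZ₁₀, hZ₂₀, hW₁₀, hW₂₀]
  have hE : ∀ p, shiftedEnergy (2 * b) b (2 * b) (c / 3) (c / 3) (hexRotation c p) =
      shiftedEnergy (2 * b) b (2 * b) (c / 3) (c / 3) p := by
    intro p
    simp only [shiftedEnergy, hexRotation, Equiv.coe_fn_mk]
    push_cast
    ring
  have hφ : ∀ p : ℤ × ℤ, ((hexRotation c p).1 : ℝ) * (m / 3 * (2 * Real.pi)) +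
      (hexRotation c p).2 * -(m / 3 * (2 * Real.pi)) =
      (p.1 * (m / 3 * (2 * Real.pi)) + p.2 * -(m / 3 * (2 * Real.pi))) -
        ((m * p.1 : ℤ) : ℝ) * (2 * Real.pi) := by
    intro p
    have hcm' : (c : ℝ) * m = 0 := by exact_mod_cast hcm
    simp only [hexRotation, Equiv.coe_fn_mk]
    push_cast
    linear_combination (-(2 * Real.pi) / 3) * hcm'
  refine tsum_eq_zero_of_orbit_sum_eq_zero (hexRotation c) (fun p => ?_)
  simp only [hE, hφ, Real.cos_sub_int_mul_two_pi, Real.sin_sub_int_mul_two_pi]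
  have hcS : c * Real.sin (p.1 * (m / 3 * (2 * Real.pi)) + p.2 * -(m / 3 * (2 * Real.pi))) = 0 := by
    rcases mul_eq_zero.1 hcm with h | h <;> simp [h]
  revert hcS
  generalize Real.cos _ = C
  generalize Real.sin _ = S
  intro hcS
  generalize Real.exp _ = e
  simp only [shiftedEnergyDeriv, hexRotation, Equiv.coe_fn_mk]
  push_cast
  rw [show deriv B t₀ = deriv A t₀ + deriv D t₀ by linarith]
  linear_combination e * (deriv W₁ t₀ + deriv W₂ t₀) * hcS

section HexagonalCurve

variable {X Y : ℝ → ℝ} {t₀ : ℝ}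

lemma deriv_hexagonal_form_trace_eq_zero {x' y' : ℝ} (hX : HasDerivAt X x' t₀)
    (hY : HasDerivAt Y y' t₀) (hX₀ : X t₀ = 1 / 2) (hY₀ : Y t₀ = Real.sqrt 3 / 2) (r : ℝ) :
    deriv (fun t => r / Y t) t₀ - deriv (fun t => r / Y t * X t) t₀ +
      deriv (fun t => r / Y t * (X t ^ 2 + Y t ^ 2)) t₀ = 0 := by
  have h3 : Real.sqrt 3 ^ 2 = 3 := Real.sq_sqrt (by norm_num)
  have hs : Real.sqrt 3 ≠ 0 := by positivity
  have hA := (hasDerivAt_const t₀ r).fun_div hY (by rw [hY₀]; positivity)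
  rw [hA.deriv, (hA.fun_mul hX).deriv,
    (hA.fun_mul ((hX.fun_pow 2).fun_add (hY.fun_pow 2))).deriv, hX₀, hY₀]
  field_simp
  ring_nf
  rw [h3]
  ring

/-- A theta series with shift and charge fixed by a third of a turn is stationary at the
hexagonal lattice along every `C¹` curve `(X, Y)` of lattice parameters. -/
theorem hasDerivAt_tsum_zero_of_hexagonal_lattice {Z₁ Z₂ W₁ W₂ : ℝ → ℝ}
    (hX : ContDiffAt ℝ 1 X t₀) (hY : ContDiffAt ℝ 1 Y t₀)
    (hX₀ : X t₀ = 1 / 2) (hY₀ : Y t₀ = Real.sqrt 3 / 2)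
    (hZ₁ : ContDiffAt ℝ 1 Z₁ t₀) (hZ₂ : ContDiffAt ℝ 1 Z₂ t₀)
    (hW₁ : ContDiffAt ℝ 1 W₁ t₀) (hW₂ : ContDiffAt ℝ 1 W₂ t₀) {c m : ℤ} (hcm : c * m = 0)
    (hZ₁₀ : Z₁ t₀ = c / 3) (hZ₂₀ : Z₂ t₀ = c / 3) (hW₁₀ : W₁ t₀ = m / 3 * (2 * Real.pi))
    (hW₂₀ : W₂ t₀ = -(m / 3 * (2 * Real.pi))) {r : ℝ} (hr : 0 < r) :
    HasDerivAt (fun t => ∑' p : ℤ × ℤ,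
        Real.exp (-shiftedEnergy (r / Y t) (r / Y t * X t) (r / Y t * (X t ^ 2 + Y t ^ 2))
          (Z₁ t) (Z₂ t) p) * Real.cos (p.1 * W₁ t + p.2 * W₂ t)) 0 t₀ := by
  have h3 : Real.sqrt 3 ^ 2 = 3 := Real.sq_sqrt (by norm_num)
  have hA : ContDiffAt ℝ 1 (fun t => r / Y t) t₀ :=
    contDiffAt_const.div hY (by rw [hY₀]; positivity)
  refine hasDerivAt_tsum_zero_of_hexagonal (b := r / Real.sqrt 3) hA (hA.mul hX)
    (hA.mul ((hX.pow 2).add (hY.pow 2))) hZ₁ hZ₂ hW₁ hW₂ (by positivity) ?_ ?_ ?_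
    (deriv_hexagonal_form_trace_eq_zero (hX.differentiableAt one_ne_zero).hasDerivAt
      (hY.differentiableAt one_ne_zero).hasDerivAt hX₀ hY₀ r) hcm hZ₁₀ hZ₂₀ hW₁₀ hW₂₀
  · rw [hY₀]
    field_simp
  · rw [hX₀, hY₀]
    field_simp
  · rw [hX₀, hY₀, div_pow (Real.sqrt 3), h3]
    field_simp
    norm_num

lemma bPoint_hexagonal : bPoint (1 / 2) (Real.sqrt 3 / 2) = (1 / 3, 1 / 3) := by
  have h3 : Real.sqrt 3 ^ 2 = 3 := Real.sq_sqrt (by norm_num)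
  ext <;> norm_num [bPoint, div_pow, h3]

lemma contDiffAt_bPoint (hX : ContDiffAt ℝ 1 X t₀) (hY : ContDiffAt ℝ 1 Y t₀)
    (h0 : Y t₀ ≠ 0) :
    ContDiffAt ℝ 1 (fun t => (bPoint (X t) (Y t)).1) t₀ ∧
      ContDiffAt ℝ 1 (fun t => (bPoint (X t) (Y t)).2) t₀ := by
  have h8 : 8 * Y t₀ ^ 2 ≠ 0 := by positivity
  constructor
  · exact ContDiffAt.div (by fun_prop) (by fun_prop) h8
  · exact ContDiffAt.div (by fun_prop) (by fun_prop) h8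

theorem hasDerivAt_latticeTheta_bPoint_hexagonal (hX : ContDiffAt ℝ 1 X t₀)
    (hY : ContDiffAt ℝ 1 Y t₀) (hX₀ : X t₀ = 1 / 2) (hY₀ : Y t₀ = Real.sqrt 3 / 2) {α : ℝ}
    (hα : 0 < α) :
    HasDerivAt (fun t => latticeTheta (X t) (Y t) (bPoint (X t) (Y t)) α) 0 t₀ := by
  obtain ⟨hb₁, hb₂⟩ := contDiffAt_bPoint hX hY (by rw [hY₀]; positivity)
  convert hasDerivAt_tsum_zero_of_hexagonal_lattice (W₁ := fun _ => 0) (W₂ := fun _ => 0)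
    (c := 1) (m := 0) hX hY hX₀ hY₀ hb₁ hb₂ contDiffAt_const contDiffAt_const (by simp)
    (by simp [hX₀, hY₀, bPoint_hexagonal, -one_div])
    (by simp [hX₀, hY₀, bPoint_hexagonal, -one_div])
    (by simp) (by simp) (mul_pos Real.pi_pos hα) using 1
  funext t
  refine tsum_congr (fun p => ?_)
  rw [mul_zero, mul_zero, add_zero, Real.cos_zero, mul_one, shiftedEnergy]
  congr 1
  ring

theorem hasDerivAt_latticeThetaHat_bPoint_hexagonal (hX : ContDiffAt ℝ 1 X t₀)
    (hY : ContDiffAt ℝ 1 Y t₀) (hX₀ : X t₀ = 1 / 2) (hY₀ : Y t₀ = Real.sqrt 3 / 2) {α : ℝ}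
    (hα : 0 < α) :
    HasDerivAt (fun t => latticeThetaHat (X t) (Y t) (bPoint (X t) (Y t)) α) 0 t₀ := by
  obtain ⟨hb₁, hb₂⟩ := contDiffAt_bPoint hX hY (by rw [hY₀]; positivity)
  convert hasDerivAt_tsum_zero_of_hexagonal_lattice (Z₁ := fun _ => 0) (Z₂ := fun _ => 0)
    (W₁ := fun t => (bPoint (X t) (Y t)).2 * (2 * Real.pi))
    (W₂ := fun t => -((bPoint (X t) (Y t)).1 * (2 * Real.pi)))
    (c := 0) (m := 1) hX hY hX₀ hY₀ contDiffAt_const contDiffAt_const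
    (hb₂.mul contDiffAt_const) (hb₁.mul contDiffAt_const).neg (by simp) (by simp) (by simp)
    (by rw [hX₀, hY₀, bPoint_hexagonal]; simp) (by rw [hX₀, hY₀, bPoint_hexagonal]; simp)
    (mul_pos Real.pi_pos hα) using 1
  funext t
  refine tsum_congr (fun p => ?_)
  rw [shiftedEnergy]
  congr 2 <;> ring

end HexagonalCurve

/-- The hexagonal lattice `(1/2, √3/2)` is a critical point of both
`(x,y) ↦ θ_{x,y}(b(x,y);α)` and `(x,y) ↦ θ̂_{x,y}(b(x,y);α)`, for every `α > 0`. -/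
theorem hexagonal_critical (α : ℝ) (hα : 0 < α) :
    HasDerivAt (fun x => latticeTheta x (Real.sqrt 3 / 2) (bPoint x (Real.sqrt 3 / 2)) α)
      0 (1 / 2) ∧
    HasDerivAt (fun y => latticeTheta (1 / 2) y (bPoint (1 / 2) y) α) 0 (Real.sqrt 3 / 2) ∧
    HasDerivAt (fun x => latticeThetaHat x (Real.sqrt 3 / 2) (bPoint x (Real.sqrt 3 / 2)) α)
      0 (1 / 2) ∧
    HasDerivAt (fun y => latticeThetaHat (1 / 2) y (bPoint (1 / 2) y) α) 0 (Real.sqrt 3 / 2) := by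
  exact ⟨hasDerivAt_latticeTheta_bPoint_hexagonal contDiffAt_id contDiffAt_const rfl rfl hα,
    hasDerivAt_latticeTheta_bPoint_hexagonal contDiffAt_const contDiffAt_id rfl rfl hα,
    hasDerivAt_latticeThetaHat_bPoint_hexagonal contDiffAt_id contDiffAt_const rfl rfl hα,
    hasDerivAt_latticeThetaHat_bPoint_hexagonal contDiffAt_const contDiffAt_id rfl rfl hα⟩
end

section
/- For every t > 0, the function β ↦ ϑ(β;t) is even and 1-periodic in β, strictly decreasing on the interval (0,1/2), and strictly increasing on (1/2,1); consequently ϑ(1/2;t) ≤ ϑ(β;t) ≤ ϑ(0;t) for all β ∈ ℝ, with global maxima exactly at β ∈ ℤ and global minima exactly at β ∈ ℤ + 1/2. The same statements hold for β ↦ ϑ̂(β;t). -/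
/-- The one-dimensional theta function `ϑ(β;t) = ∑_{k∈ℤ} exp(−πt(k+β)²)`. -/
noncomputable def jacobiThetaShift (β t : ℝ) : ℝ :=
  ∑' k : ℤ, Real.exp (-Real.pi * t * ((k : ℝ) + β) ^ 2)

/-- The one-dimensional theta function `ϑ̂(β;t) = ∑_{k∈ℤ} exp(−πtk²)·cos(2πkβ)`. -/
noncomputable def jacobiThetaMod (β t : ℝ) : ℝ :=
  ∑' k : ℤ, Real.exp (-Real.pi * t * (k : ℝ) ^ 2) * Real.cos (2 * Real.pi * (k : ℝ) * β)

open Filter Topology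

/-- The reciprocal `1 / (p; p)_n` of the `q`-Pochhammer symbol, extended by zero to `n < 0`. -/
noncomputable def invQPochhammer (p : ℝ) : ℤ → ℝ
  | Int.ofNat n => ∏ i ∈ Finset.range n, (1 - p ^ (i + 1))⁻¹
  | Int.negSucc _ => 0

lemma invQPochhammer_sub_one {p : ℝ} (hp0 : 0 < p) (hp1 : p < 1) (n : ℤ) :
    invQPochhammer p (n - 1) = invQPochhammer p n * (1 - p ^ n) := by
  rcases n with n | n
  · rcases n with _ | n
    · rw [show (Int.ofNat 0 - 1 : ℤ) = Int.negSucc 0 from rfl]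
      simp [invQPochhammer]
    · have h1 : (Int.ofNat (n + 1) - 1 : ℤ) = Int.ofNat n := by simp
      have h2 : (1 - p ^ (n + 1)) ≠ 0 :=
        (sub_pos.2 (pow_lt_one₀ hp0.le hp1 (Nat.succ_ne_zero n))).ne'
      rw [h1]
      simp only [invQPochhammer, Finset.prod_range_succ, Int.ofNat_eq_natCast, zpow_natCast]
      field_simp
  · rw [show Int.negSucc n - 1 = Int.negSucc (n + 1) by omega]
    simp [invQPochhammer]

lemma invQPochhammer_zero (p : ℝ) : invQPochhammer p 0 = 1 := by
  simp [invQPochhammer]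

lemma invQPochhammer_of_neg (p : ℝ) {n : ℤ} (hn : n < 0) : invQPochhammer p n = 0 := by
  rcases n with n | n
  · exact absurd hn (by simp)
  · rfl

lemma invQPochhammer_nonneg {p : ℝ} (hp0 : 0 < p) (hp1 : p < 1) (n : ℤ) :
    0 ≤ invQPochhammer p n := by
  rcases n with n | n
  · exact Finset.prod_nonneg fun i _ =>
      inv_nonneg.2 (sub_nonneg.2 (pow_le_one₀ hp0.le hp1.le))
  · rfl

lemma invQPochhammer_mono {p : ℝ} (hp0 : 0 < p) (hp1 : p < 1) :
    Monotone (invQPochhammer p) := by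
  refine monotone_int_of_le_succ fun n => ?_
  have h := invQPochhammer_sub_one hp0 hp1 (n + 1)
  rw [add_sub_cancel_right] at h
  rw [h]
  exact mul_le_of_le_one_right (invQPochhammer_nonneg hp0 hp1 _)
    (sub_le_self _ (zpow_nonneg hp0.le _))

lemma invQPochhammer_le {p : ℝ} (hp0 : 0 < p) (hp1 : p < 1) (n : ℤ) :
    invQPochhammer p n ≤ Real.exp (∑' i : ℕ, p ^ (i + 1) / (1 - p)) := by
  rcases n with n | n
  · have hs : Summable fun i : ℕ => p ^ (i + 1) / (1 - p) :=
      ((summable_nat_add_iff 1).2 (summable_geometric_of_lt_one hp0.le hp1)).div_const _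
    have hpos : 0 < 1 - p := sub_pos.2 hp1
    calc ∏ i ∈ Finset.range n, (1 - p ^ (i + 1))⁻¹
        ≤ ∏ i ∈ Finset.range n, Real.exp (p ^ (i + 1) / (1 - p)) := by
          refine Finset.prod_le_prod (fun i _ =>
            inv_nonneg.2 (sub_nonneg.2 (pow_le_one₀ hp0.le hp1.le))) fun i _ => ?_
          have hle : p ^ (i + 1) ≤ p := by
            simpa using pow_le_pow_of_le_one hp0.le hp1.le (Nat.le_add_left 1 i)
          have h2 : 0 < 1 - p ^ (i + 1) := by linarith
          calc (1 - p ^ (i + 1))⁻¹ = p ^ (i + 1) / (1 - p ^ (i + 1)) + 1 := by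
                field_simp; ring
            _ ≤ p ^ (i + 1) / (1 - p) + 1 := by gcongr
            _ ≤ _ := Real.add_one_le_exp _
      _ = Real.exp (∑ i ∈ Finset.range n, p ^ (i + 1) / (1 - p)) := (Real.exp_sum _ _).symm
      _ ≤ _ := Real.exp_le_exp.2 (hs.sum_le_tsum _ fun i _ => by positivity)
  · exact (Real.exp_pos _).le

lemma exists_tendsto_invQPochhammer {p : ℝ} (hp0 : 0 < p) (hp1 : p < 1) :
    ∃ L, 0 < L ∧ Tendsto (invQPochhammer p) atTop (𝓝 L) := by
  have hbdd : BddAbove (Set.range (invQPochhammer p)) :=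
    ⟨_, Set.forall_mem_range.2 (invQPochhammer_le hp0 hp1)⟩
  refine ⟨_, ?_, tendsto_atTop_ciSup (invQPochhammer_mono hp0 hp1) hbdd⟩
  exact lt_of_lt_of_le (by simp [invQPochhammer_zero]) (le_ciSup hbdd 0)

/-- The finite form of Jacobi's triple product identity. -/
lemma hasSum_finite_tripleProduct {q : ℝ} (hq0 : 0 < q) (hq1 : q < 1) (x : ℝ) (N : ℕ) (φ : ℝ) :
    HasSum (fun k : ℤ => q ^ (k ^ 2) *
        (invQPochhammer (q ^ 2) (N + k) * invQPochhammer (q ^ 2) (N - k)) * Real.cos (k * x + φ))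
      (Real.cos φ * (invQPochhammer (q ^ 2) (2 * N) * ∏ n ∈ Finset.range N,
        (1 + 2 * q ^ (2 * n + 1) * Real.cos x + (q ^ (2 * n + 1)) ^ 2))) := by
  have hp0 : 0 < q ^ 2 := by positivity
  have hp1 : q ^ 2 < 1 := pow_lt_one₀ hq0.le hq1 two_ne_zero
  induction N generalizing φ with
  | zero =>
    convert hasSum_single (0 : ℤ) ?_ using 1
    · simp [invQPochhammer_zero]
    · intro k hk
      rcases lt_or_gt_of_ne hk with h | h
      · simp [invQPochhammer_of_neg _ h]
      · simp [invQPochhammer_of_neg _ (neg_neg_of_pos h)]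
  | succ N ih =>
    have hsub := invQPochhammer_sub_one hp0 hp1
    have hprev := (Equiv.subRight (1 : ℤ)).hasSum_iff.2 (ih (φ + x))
    have hnext := (Equiv.addRight (1 : ℤ)).hasSum_iff.2 (ih (φ - x))
    have hstep := ((ih φ).mul_left (1 + (q ^ (2 * N + 1)) ^ 2)).add
      ((hprev.add hnext).mul_left (q ^ (2 * N + 1)))
    have hne (n : ℕ) : 1 - (q ^ 2) ^ (n + 1) ≠ 0 :=
      (sub_pos.2 (pow_lt_one₀ hp0.le hp1 n.succ_ne_zero)).ne'
    have hD : (1 - (q ^ 2) ^ (2 * N + 1)) * (1 - (q ^ 2) ^ (2 * N + 2)) ≠ 0 :=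
      mul_ne_zero (hne _) (hne _)
    have hfin := hstep.mul_left ((1 - (q ^ 2) ^ (2 * N + 1)) * (1 - (q ^ 2) ^ (2 * N + 2)))⁻¹
    refine Eq.subst (motive := fun a => HasSum _ a) (Eq.symm ?_)
      (hfin.congr_fun fun k => ?_)
    rotate_left
    · rw [eq_inv_mul_iff_mul_eq₀ hD]
      simp only [Function.comp_apply, Equiv.subRight_apply, Equiv.coe_addRight]
      have e1 : (((k - 1 : ℤ) : ℝ) * x + (φ + x)) = k * x + φ := by push_cast; ring
      have e2 : (((k + 1 : ℤ) : ℝ) * x + (φ - x)) = k * x + φ := by push_cast; ring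
      have a1 : invQPochhammer (q ^ 2) (N + k) = invQPochhammer (q ^ 2) (N + 1 + k) *
          (1 - (q ^ 2) ^ (N + 1 + k : ℤ)) := by rw [← hsub]; congr 1; ring
      have a2 : invQPochhammer (q ^ 2) (N + (k - 1)) = invQPochhammer (q ^ 2) (N + k) *
          (1 - (q ^ 2) ^ (N + k : ℤ)) := by rw [← hsub]; congr 1; ring
      have b1 : invQPochhammer (q ^ 2) (N - k) = invQPochhammer (q ^ 2) (N + 1 - k) *
          (1 - (q ^ 2) ^ (N + 1 - k : ℤ)) := by rw [← hsub]; congr 1; ring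
      have b2 : invQPochhammer (q ^ 2) (N - (k + 1)) = invQPochhammer (q ^ 2) (N - k) *
          (1 - (q ^ 2) ^ (N - k : ℤ)) := by rw [← hsub]; congr 1; ring
      rw [e1, e2, a2, b2, a1, b1, show (N - (k - 1) : ℤ) = N + 1 - k by ring,
        show (N + (k + 1) : ℤ) = N + 1 + k by ring]
      push_cast
      generalize invQPochhammer (q ^ 2) (N + 1 + k) = A
      generalize invQPochhammer (q ^ 2) (N + 1 - k) = B
      generalize Real.cos (k * x + φ) = c
      have hq := hq0.ne'
      have z1 : q ^ ((k - 1) ^ 2 : ℤ) = q ^ (k ^ 2) * q / (q ^ k) ^ 2 := by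
        rw [show ((k - 1) ^ 2 : ℤ) = k ^ 2 + 1 - k * 2 by ring, zpow_sub₀ hq, zpow_add₀ hq,
          zpow_mul, zpow_one]
        norm_cast
      have z2 : q ^ ((k + 1) ^ 2 : ℤ) = q ^ (k ^ 2) * q * (q ^ k) ^ 2 := by
        rw [show ((k + 1) ^ 2 : ℤ) = k ^ 2 + 1 + k * 2 by ring, zpow_add₀ hq, zpow_add₀ hq,
          zpow_mul, zpow_one]
        norm_cast
      have z3 (m : ℤ) : (q ^ 2) ^ m = (q ^ m) ^ 2 := by
        rw [← zpow_natCast, ← zpow_natCast, ← zpow_mul, ← zpow_mul, mul_comm]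
      have hk : q ^ k ≠ 0 := zpow_ne_zero _ hq
      have hN : q ^ N ≠ 0 := pow_ne_zero _ hq
      simp only [z1, z2, z3, zpow_sub₀ hq, zpow_add₀ hq, zpow_natCast, zpow_one]
      generalize q ^ (k ^ 2) = E
      generalize q ^ k = K at *
      have w1 : (q ^ 2) ^ (2 * N + 1) = (q ^ N) ^ 4 * q ^ 2 := by ring
      have w2 : (q ^ 2) ^ (2 * N + 2) = (q ^ N) ^ 4 * q ^ 4 := by ring
      have w3 : q ^ (2 * N + 1) = (q ^ N) ^ 2 * q := by ring
      rw [w1, w2, w3]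
      generalize q ^ N = M at *
      field_simp
      ring
    · rw [eq_inv_mul_iff_mul_eq₀ hD, Finset.prod_range_succ, Real.cos_add, Real.cos_sub]
      have h1 := hsub (2 * N + 2)
      have h2 := hsub (2 * N + 1)
      rw [show (2 * N + 2 - 1 : ℤ) = 2 * N + 1 by ring] at h1
      rw [show (2 * N + 1 - 1 : ℤ) = 2 * N by ring, h1] at h2
      have h3 : (q ^ 2) ^ (2 * N + 1 : ℤ) = (q ^ 2) ^ (2 * N + 1) := by norm_cast
      have h4 : (q ^ 2) ^ (2 * N + 2 : ℤ) = (q ^ 2) ^ (2 * N + 2) := by norm_cast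
      rw [h3, h4] at h2
      rw [h2]
      push_cast
      rw [show (2 * (N + 1) : ℤ) = 2 * N + 2 by ring]
      ring

lemma exists_tendsto_tripleProduct {q : ℝ} (hq0 : 0 < q) (hq1 : q < 1)
    (hs : Summable fun k : ℤ => q ^ (k ^ 2)) :
    ∃ L, 0 < L ∧ ∀ x : ℝ, Tendsto (fun N : ℕ => invQPochhammer (q ^ 2) (2 * N) *
        ∏ n ∈ Finset.range N, (1 + 2 * q ^ (2 * n + 1) * Real.cos x + (q ^ (2 * n + 1)) ^ 2))
      atTop (𝓝 (L * ∑' k : ℤ, q ^ (k ^ 2) * Real.cos (k * x))) := by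
  have hp0 : 0 < q ^ 2 := by positivity
  have hp1 : q ^ 2 < 1 := pow_lt_one₀ hq0.le hq1 two_ne_zero
  obtain ⟨L, hL, hlim⟩ := exists_tendsto_invQPochhammer hp0 hp1
  refine ⟨L * L, mul_pos hL hL, fun x => ?_⟩
  have hR := invQPochhammer_nonneg hp0 hp1
  have hM := invQPochhammer_le hp0 hp1
  set M := Real.exp (∑' i : ℕ, (q ^ 2) ^ (i + 1) / (1 - q ^ 2))
  have key := tendsto_tsum_of_dominated_convergence (𝓕 := (atTop : Filter ℕ))
    (f := fun (N : ℕ) (k : ℤ) => q ^ (k ^ 2) *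
        (invQPochhammer (q ^ 2) (N + k) * invQPochhammer (q ^ 2) (N - k)) * Real.cos (k * x + 0))
    (g := fun k : ℤ => q ^ (k ^ 2) * (L * L) * Real.cos (k * x + 0))
    (hs.mul_right (M * M)) (fun k => ?_) (Eventually.of_forall fun N k => ?_)
  · convert key using 2 with N
    · rw [(hasSum_finite_tripleProduct hq0 hq1 x N 0).tsum_eq, Real.cos_zero, one_mul]
    · rw [← tsum_mul_left]
      exact tsum_congr fun k => by rw [add_zero]; ring
  · refine (tendsto_const_nhds.mul (Tendsto.mul (hlim.comp ?_) (hlim.comp ?_))).mul_const _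
    · exact tendsto_atTop_add_const_right _ _ tendsto_natCast_atTop_atTop
    · exact tendsto_atTop_add_const_right _ _ tendsto_natCast_atTop_atTop
  · rw [norm_mul, norm_mul, norm_mul, Real.norm_of_nonneg (zpow_nonneg hq0.le _),
      Real.norm_of_nonneg (hR _), Real.norm_of_nonneg (hR _)]
    refine mul_le_of_le_one_right ?_ (Real.abs_cos_le_one _) |>.trans ?_
    · have := hR (N + k); have := hR (N - k); have := zpow_nonneg hq0.le (k ^ 2); positivity
    · exact mul_le_mul_of_nonneg_left (mul_le_mul (hM _) (hM _) (hR _) (Real.exp_pos _).le)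
        (zpow_nonneg hq0.le _)

lemma one_add_two_mul_cos_pos {a : ℝ} (ha0 : 0 < a) (ha1 : a < 1) (x : ℝ) :
    0 < 1 + 2 * a * Real.cos x + a ^ 2 := by
  nlinarith [Real.neg_one_le_cos x, sq_pos_of_pos (sub_pos.2 ha1)]

/-- Cosine series with theta coefficients inherit the strict dependence on `cos x` of their
triple product. -/
lemma tsum_cos_lt_of_cos_lt {q : ℝ} (hq0 : 0 < q) (hq1 : q < 1)
    (hs : Summable fun k : ℤ => q ^ (k ^ 2)) {x y : ℝ} (hxy : Real.cos y < Real.cos x)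
    (hpos : 0 < ∑' k : ℤ, q ^ (k ^ 2) * Real.cos (k * y)) :
    ∑' k : ℤ, q ^ (k ^ 2) * Real.cos (k * y) < ∑' k : ℤ, q ^ (k ^ 2) * Real.cos (k * x) := by
  have hp0 : 0 < q ^ 2 := by positivity
  have hp1 : q ^ 2 < 1 := pow_lt_one₀ hq0.le hq1 two_ne_zero
  obtain ⟨L, hL, hlim⟩ := exists_tendsto_tripleProduct hq0 hq1 hs
  have hfac (n : ℕ) (z : ℝ) := one_add_two_mul_cos_pos (pow_pos hq0 (2 * n + 1))
    (pow_lt_one₀ hq0.le hq1 (Nat.succ_ne_zero (2 * n))) z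
  have hfx := one_add_two_mul_cos_pos hq0 hq1 x
  have hfy := one_add_two_mul_cos_pos hq0 hq1 y
  have hle := le_of_tendsto_of_tendsto ((hlim y).mul_const (1 + 2 * q * Real.cos x + q ^ 2))
    ((hlim x).mul_const (1 + 2 * q * Real.cos y + q ^ 2)) (by
      filter_upwards [eventually_ge_atTop 1] with N hN
      obtain ⟨m, rfl⟩ := Nat.exists_eq_add_of_le' hN
      have hprod : ∏ n ∈ Finset.range m, (1 + 2 * q ^ (2 * (n + 1) + 1) * Real.cos y +
            (q ^ (2 * (n + 1) + 1)) ^ 2) ≤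
          ∏ n ∈ Finset.range m, (1 + 2 * q ^ (2 * (n + 1) + 1) * Real.cos x +
            (q ^ (2 * (n + 1) + 1)) ^ 2) :=
        Finset.prod_le_prod (fun n _ => (hfac (n + 1) y).le) fun n _ => by gcongr
      simp only [Finset.prod_range_succ', mul_zero, zero_add, pow_one]
      have := mul_le_mul_of_nonneg_left hprod (mul_nonneg (mul_nonneg
        (invQPochhammer_nonneg hp0 hp1 (2 * ((m + 1 : ℕ) : ℤ))) hfx.le) hfy.le)
      linarith)
  have hlt : 1 + 2 * q * Real.cos y + q ^ 2 < 1 + 2 * q * Real.cos x + q ^ 2 := by gcongr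
  rw [mul_assoc L, mul_assoc L] at hle
  have hle' := le_of_mul_le_mul_left hle hL
  have := mul_lt_mul_of_pos_left hlt hpos
  exact lt_of_mul_lt_mul_right (this.trans_le hle') hfy.le

lemma jacobiThetaShift_eq_evenKernel (β : ℝ) {t : ℝ} (ht : 0 < t) :
    jacobiThetaShift β t = HurwitzZeta.evenKernel β t := by
  rw [← (HurwitzZeta.hasSum_int_evenKernel β ht).tsum_eq]
  exact tsum_congr fun k => by ring_nf

lemma hasSum_jacobiThetaMod (β : ℝ) {t : ℝ} (ht : 0 < t) :
    HasSum (fun k : ℤ => Real.exp (-Real.pi * t * (k : ℝ) ^ 2) *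
      Real.cos (2 * Real.pi * (k : ℝ) * β)) (HurwitzZeta.cosKernel β t) := by
  have h := Complex.hasSum_re (HurwitzZeta.hasSum_int_cosKernel β ht)
  rw [Complex.ofReal_re] at h
  refine h.congr_fun fun k => ?_
  rw [Complex.re_mul_ofReal, show 2 * (Real.pi : ℂ) * Complex.I * β * k =
    ((2 * Real.pi * k * β : ℝ) : ℂ) * Complex.I by push_cast; ring, Complex.exp_ofReal_mul_I_re]
  ring_nf

lemma jacobiThetaMod_eq_cosKernel (β : ℝ) {t : ℝ} (ht : 0 < t) :
    jacobiThetaMod β t = HurwitzZeta.cosKernel β t :=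
  (hasSum_jacobiThetaMod β ht).tsum_eq

lemma jacobiThetaShift_pos (β : ℝ) {t : ℝ} (ht : 0 < t) : 0 < jacobiThetaShift β t := by
  have hs := (HurwitzZeta.hasSum_int_evenKernel β ht).summable
  refine Summable.tsum_pos (hs.congr fun k => ?_) (fun k => (Real.exp_pos _).le) 0
    (Real.exp_pos _)
  ring_nf

/-- The Poisson summation formula relating the two theta functions. -/
lemma jacobiThetaShift_eq_mul_jacobiThetaMod (β : ℝ) {t : ℝ} (ht : 0 < t) :
    jacobiThetaShift β t = 1 / t ^ (1 / 2 : ℝ) * jacobiThetaMod β (1 / t) := by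
  rw [jacobiThetaShift_eq_evenKernel β ht, jacobiThetaMod_eq_cosKernel β (one_div_pos.2 ht),
    HurwitzZeta.evenKernel_functional_equation]

lemma jacobiThetaMod_pos (β : ℝ) {t : ℝ} (ht : 0 < t) : 0 < jacobiThetaMod β t := by
  have ht' := one_div_pos.2 ht
  have h := jacobiThetaShift_pos β ht'
  rw [jacobiThetaShift_eq_mul_jacobiThetaMod β ht', one_div_one_div] at h
  exact pos_of_mul_pos_right h (by positivity)

lemma strictAntiOn_jacobiThetaMod {t : ℝ} (ht : 0 < t) :
    StrictAntiOn (fun β => jacobiThetaMod β t) (Set.Icc 0 (1 / 2)) := by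
  have hexp (k : ℤ) : Real.exp (-Real.pi * t * (k : ℝ) ^ 2) =
      Real.exp (-Real.pi * t) ^ (k ^ 2) := by
    rw [← Real.rpow_intCast, ← Real.exp_mul]
    push_cast
    ring_nf
  have heq (β : ℝ) : jacobiThetaMod β t = ∑' k : ℤ,
      Real.exp (-Real.pi * t) ^ (k ^ 2) * Real.cos (k * (2 * Real.pi * β)) :=
    tsum_congr fun k => by rw [hexp]; ring_nf
  have hs : Summable fun k : ℤ => Real.exp (-Real.pi * t) ^ (k ^ 2) :=
    (hasSum_jacobiThetaMod 0 ht).summable.congr fun k => by rw [← hexp]; simp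
  intro x hx y hy hxy
  have hpos := jacobiThetaMod_pos y ht
  rw [heq] at hpos
  simp only [heq]
  refine tsum_cos_lt_of_cos_lt (Real.exp_pos _) ?_ hs ?_ hpos
  · rw [Real.exp_lt_one_iff]
    nlinarith [Real.pi_pos]
  · have := Real.pi_pos
    refine Real.cos_lt_cos_of_nonneg_of_le_pi ?_ ?_ ?_
    · have := hx.1; positivity
    · nlinarith [hy.2]
    · gcongr

lemma strictAntiOn_jacobiThetaShift {t : ℝ} (ht : 0 < t) :
    StrictAntiOn (fun β => jacobiThetaShift β t) (Set.Icc 0 (1 / 2)) := by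
  intro x hx y hy hxy
  simp only [jacobiThetaShift_eq_mul_jacobiThetaMod _ ht]
  exact mul_lt_mul_of_pos_left (strictAntiOn_jacobiThetaMod (one_div_pos.2 ht) hx hy hxy)
    (by positivity)

lemma monotonicity_of_even_periodic {f : ℝ → ℝ} (heven : ∀ β, f (-β) = f β)
    (hper : ∀ β, f (β + 1) = f β) (hanti : StrictAntiOn f (Set.Icc 0 (1 / 2))) :
    StrictAntiOn f (Set.Ioo 0 (1 / 2)) ∧
    StrictMonoOn f (Set.Ioo (1 / 2) 1) ∧
    (∀ β : ℝ, f (1 / 2) ≤ f β ∧ f β ≤ f 0) ∧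
    (∀ β : ℝ, f β = f 0 ↔ ∃ k : ℤ, β = k) ∧
    (∀ β : ℝ, f β = f (1 / 2) ↔ ∃ k : ℤ, β = k + 1 / 2) := by
  have hint (β : ℝ) (k : ℤ) : f (β + k) = f β := by
    simpa using (show Function.Periodic f 1 from hper).int_mul k β
  have habs (β : ℝ) : f |β - round β| = f β := by
    have h := hint β (-round β)
    rcases abs_choice (β - round β) with h' | h' <;> rw [h']
    · simpa [sub_eq_add_neg] using h
    · rw [heven]
      simpa [sub_eq_add_neg] using h
  have hmem (β : ℝ) : |β - round β| ∈ Set.Icc (0 : ℝ) (1 / 2) :=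
    ⟨abs_nonneg _, abs_sub_round β⟩
  have h0 : (0 : ℝ) ∈ Set.Icc (0 : ℝ) (1 / 2) := by norm_num
  have h1 : (1 / 2 : ℝ) ∈ Set.Icc (0 : ℝ) (1 / 2) := by norm_num
  refine ⟨hanti.mono Set.Ioo_subset_Icc_self, ?_, fun β => ?_, fun β => ⟨fun h => ?_, ?_⟩,
    fun β => ⟨fun h => ?_, ?_⟩⟩
  · intro x hx y hy hxy
    have hrefl (z : ℝ) : f (1 - z) = f z := by
      rw [sub_eq_neg_add, hper, heven]
    rw [← hrefl x, ← hrefl y]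
    exact hanti ⟨by linarith [hy.2], by linarith [hy.1]⟩ ⟨by linarith [hx.2], by linarith [hx.1]⟩
      (by linarith)
  · rw [← habs β]
    exact ⟨hanti.antitoneOn (hmem β) h1 (hmem β).2, hanti.antitoneOn h0 (hmem β) (hmem β).1⟩
  · rw [← habs β] at h
    exact ⟨round β, sub_eq_zero.1 (abs_eq_zero.1 (hanti.injOn (hmem β) h0 h))⟩
  · rintro ⟨k, rfl⟩
    simpa using hint 0 k
  · rw [← habs β] at h
    rcases (abs_eq (by norm_num)).1 (hanti.injOn (hmem β) h1 h) with h' | h'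
    · exact ⟨round β, by linarith⟩
    · exact ⟨round β - 1, by push_cast; linarith⟩
  · rintro ⟨k, rfl⟩
    rw [add_comm]
    exact hint _ k

/-- Montgomery's lemma: for each `t > 0`, both `β ↦ ϑ(β;t)` and `β ↦ ϑ̂(β;t)` are even,
1-periodic, strictly decreasing on `(0,1/2)`, strictly increasing on `(1/2,1)`, have global
maxima exactly at the integers and global minima exactly at the half-integers. -/
theorem theta1d_monotonicity (t : ℝ) (ht : 0 < t) :
    ((∀ β : ℝ, jacobiThetaShift (-β) t = jacobiThetaShift β t) ∧
     (∀ β : ℝ, jacobiThetaShift (β + 1) t = jacobiThetaShift β t) ∧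
     StrictAntiOn (fun β => jacobiThetaShift β t) (Set.Ioo 0 (1 / 2)) ∧
     StrictMonoOn (fun β => jacobiThetaShift β t) (Set.Ioo (1 / 2) 1) ∧
     (∀ β : ℝ, jacobiThetaShift (1 / 2) t ≤ jacobiThetaShift β t ∧
        jacobiThetaShift β t ≤ jacobiThetaShift 0 t) ∧
     (∀ β : ℝ, jacobiThetaShift β t = jacobiThetaShift 0 t ↔ ∃ k : ℤ, β = k) ∧
     (∀ β : ℝ, jacobiThetaShift β t = jacobiThetaShift (1 / 2) t ↔ ∃ k : ℤ, β = k + 1 / 2)) ∧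
    ((∀ β : ℝ, jacobiThetaMod (-β) t = jacobiThetaMod β t) ∧
     (∀ β : ℝ, jacobiThetaMod (β + 1) t = jacobiThetaMod β t) ∧
     StrictAntiOn (fun β => jacobiThetaMod β t) (Set.Ioo 0 (1 / 2)) ∧
     StrictMonoOn (fun β => jacobiThetaMod β t) (Set.Ioo (1 / 2) 1) ∧
     (∀ β : ℝ, jacobiThetaMod (1 / 2) t ≤ jacobiThetaMod β t ∧
        jacobiThetaMod β t ≤ jacobiThetaMod 0 t) ∧
     (∀ β : ℝ, jacobiThetaMod β t = jacobiThetaMod 0 t ↔ ∃ k : ℤ, β = k) ∧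
     (∀ β : ℝ, jacobiThetaMod β t = jacobiThetaMod (1 / 2) t ↔ ∃ k : ℤ, β = k + 1 / 2)) := by
  constructor
  · have heven (β : ℝ) : jacobiThetaShift (-β) t = jacobiThetaShift β t := by
      simp [jacobiThetaShift_eq_evenKernel _ ht, HurwitzZeta.evenKernel_neg]
    have hper (β : ℝ) : jacobiThetaShift (β + 1) t = jacobiThetaShift β t := by
      simp [jacobiThetaShift_eq_evenKernel _ ht]
    exact ⟨heven, hper,
      monotonicity_of_even_periodic (f := fun β => jacobiThetaShift β t) heven hper
        (strictAntiOn_jacobiThetaShift ht)⟩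
  · have heven (β : ℝ) : jacobiThetaMod (-β) t = jacobiThetaMod β t := by
      simp [jacobiThetaMod_eq_cosKernel _ ht, HurwitzZeta.cosKernel_neg]
    have hper (β : ℝ) : jacobiThetaMod (β + 1) t = jacobiThetaMod β t := by
      simp [jacobiThetaMod_eq_cosKernel _ ht]
    exact ⟨heven, hper,
      monotonicity_of_even_periodic (f := fun β => jacobiThetaMod β t) heven hper
        (strictAntiOn_jacobiThetaMod ht)⟩
end

section
/- For all integers k, l and every real y ≥ √3/2, the derivative of φ_{k,l} with respect to y satisfies |φ′_{k,l}(y)| ≤ 2·Q₁(k,l), and the second derivative satisfies |φ″_{k,l}(y)| ≤ 3·Q₁(k,l). -/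
/-- The quadratic form `Q₁(k,l) = (2/√3)(k+(l+1)/2)² + (√3/2)(l+1/3)²`. -/
noncomputable def Q1 (k l : ℤ) : ℝ :=
  2 / Real.sqrt 3 * ((k : ℝ) + ((l : ℝ) + 1) / 2) ^ 2 +
    Real.sqrt 3 / 2 * ((l : ℝ) + 1 / 3) ^ 2

/-- `φ_{k,l}(y) = (2k+l+1)²/(4y) + y(l + 1/2 − 1/(8y²))²`. -/
noncomputable def phiF (k l : ℤ) (y : ℝ) : ℝ :=
  (2 * (k : ℝ) + (l : ℝ) + 1) ^ 2 / (4 * y) +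
    y * ((l : ℝ) + 1 / 2 - 1 / (8 * y ^ 2)) ^ 2

theorem phiF_hasDerivAt (k l : ℤ) {y : ℝ} (hy : 0 < y) :
    HasDerivAt (phiF k l)
      (((l : ℝ) + 1 / 2) ^ 2 + ((l : ℝ) + 1 / 2 - (2 * (k : ℝ) + l + 1) ^ 2) / 4 * y⁻¹ ^ 2
        - 3 / 64 * y⁻¹ ^ 4) y := by
  have hne := hy.ne'
  have h4 : HasDerivAt (fun x : ℝ => 4 * x) 4 y := by
    simpa using (hasDerivAt_id y).const_mul 4
  have h8 : HasDerivAt (fun x : ℝ => 8 * x ^ 2) (8 * (2 * y)) y := by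
    simpa using (hasDerivAt_pow 2 y).const_mul 8
  have h := ((hasDerivAt_const y ((2 * (k : ℝ) + l + 1) ^ 2)).div h4 (by positivity)).add
    ((hasDerivAt_id y).mul
      (((hasDerivAt_const y ((l : ℝ) + 1 / 2)).sub
        ((hasDerivAt_const y (1 : ℝ)).div h8 (by positivity))).pow 2))
  refine h.congr_deriv ?_
  simp
  field_simp
  ring

theorem deriv_phiF_hasDerivAt (k l : ℤ) {y : ℝ} (hy : 0 < y) :
    HasDerivAt (deriv (phiF k l))
      (((2 * (k : ℝ) + l + 1) ^ 2 - ((l : ℝ) + 1 / 2)) / 2 * y⁻¹ ^ 3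
        + 3 / 16 * y⁻¹ ^ 5) y := by
  have hne := hy.ne'
  have hi := hasDerivAt_inv hne
  have h := (((hi.pow 2).const_mul (((l : ℝ) + 1 / 2 - (2 * (k : ℝ) + l + 1) ^ 2) / 4)).const_add
    (((l : ℝ) + 1 / 2) ^ 2)).sub ((hi.pow 4).const_mul (3 / 64))
  have heq : deriv (phiF k l) =ᶠ[nhds y] fun x =>
      ((l : ℝ) + 1 / 2) ^ 2 + ((l : ℝ) + 1 / 2 - (2 * (k : ℝ) + l + 1) ^ 2) / 4 * x⁻¹ ^ 2
        - 3 / 64 * x⁻¹ ^ 4 := by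
    filter_upwards [eventually_gt_nhds hy] with x hx
    exact (phiF_hasDerivAt k l hx).deriv
  refine (h.congr_of_eventuallyEq heq).congr_deriv ?_
  simp
  field_simp
  ring

/-- A rational lower bound for `Q1`, from `1732 / 1000 < √3`. -/
theorem le_two_mul_Q1 (k l : ℤ) :
    577 / 1000 * (2 * (k : ℝ) + l + 1) ^ 2 + 1732 / 1000 * ((l : ℝ) + 1 / 3) ^ 2 ≤
      2 * Q1 k l := by
  have ht : (1732 / 1000 : ℝ) ≤ √3 := Real.le_sqrt_of_sq_le (by norm_num)
  have hs : √3 ^ 2 = 3 := Real.sq_sqrt (by norm_num)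
  have hinv : 2 / √3 = 2 / 3 * √3 := by
    rw [div_eq_iff (by positivity)]
    linarith
  rw [Q1, hinv]
  nlinarith [mul_le_mul_of_nonneg_right ht (sq_nonneg (2 * (k : ℝ) + l + 1)),
    mul_le_mul_of_nonneg_right ht (sq_nonneg ((l : ℝ) + 1 / 3)),
    sq_nonneg (2 * (k : ℝ) + l + 1)]

/-- For `l = 0` the integer `2k + l + 1` is odd, so its square is at least `1`. -/
theorem eq_zero_and_one_le_sq_or (k l : ℤ) :
    ((l : ℝ) = 0 ∧ 1 ≤ (2 * (k : ℝ) + l + 1) ^ 2) ∨ 1 ≤ (l : ℝ) ∨ (l : ℝ) ≤ -1 := by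
  rcases lt_trichotomy l 0 with h | h | h
  · exact Or.inr (Or.inr (by exact_mod_cast (by omega : l ≤ -1)))
  · subst h
    refine Or.inl ⟨by simp, ?_⟩
    have hne : 2 * k + 0 + 1 ≠ 0 := by omega
    have hpos : (1 : ℤ) ≤ (2 * k + 0 + 1) ^ 2 := Int.add_one_le_of_lt (sq_pos_iff.mpr hne)
    exact_mod_cast hpos
  · exact Or.inr (Or.inl (by exact_mod_cast (by omega : 1 ≤ l)))

/-- Bounds on the first and second derivatives of `φ_{k,l}` on `[√3/2, ∞)`:
`|φ′_{k,l}(y)| ≤ 2 Q₁(k,l)` and `|φ″_{k,l}(y)| ≤ 3 Q₁(k,l)`. -/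
theorem phiF_deriv_bounds (k l : ℤ) (y : ℝ) (hy : Real.sqrt 3 / 2 ≤ y) :
    |deriv (phiF k l) y| ≤ 2 * Q1 k l ∧
    |deriv (deriv (phiF k l)) y| ≤ 3 * Q1 k l := by
  have hs : √3 ^ 2 = 3 := Real.sq_sqrt (by norm_num)
  have hy0 : 0 < y := lt_of_lt_of_le (by positivity) hy
  have hv0 : 0 < y⁻¹ := inv_pos.mpr hy0
  have hu : y⁻¹ ^ 2 ≤ 4 / 3 := by
    have hsq : (3 / 4 : ℝ) ≤ y ^ 2 := by nlinarith [Real.sqrt_nonneg 3]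
    rw [inv_pow]
    exact inv_le_of_inv_le₀ (by norm_num) (by linarith)
  have hv : y⁻¹ ≤ 1155 / 1000 := by nlinarith
  have hv3 : y⁻¹ ^ 3 ≤ 154 / 100 := by nlinarith
  have hv4 : y⁻¹ ^ 4 ≤ 16 / 9 := by nlinarith [pow_pos hv0 2]
  have hv5 : y⁻¹ ^ 5 ≤ 206 / 100 := by nlinarith [pow_pos hv0 3, pow_pos hv0 2]
  have hQ := le_two_mul_Q1 k l
  have hl := eq_zero_and_one_le_sq_or k l
  rw [(phiF_hasDerivAt k l hy0).deriv, (deriv_phiF_hasDerivAt k l hy0).deriv]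
  have hu0 := pow_pos hv0 2
  have hw0 := pow_pos hv0 3
  have hz0 := pow_pos hv0 4
  have hx0 := pow_pos hv0 5
  have hM := sq_nonneg (2 * (k : ℝ) + l + 1)
  generalize (2 * (k : ℝ) + l + 1) ^ 2 = M at *
  generalize y⁻¹ ^ 2 = u at *
  generalize y⁻¹ ^ 3 = w at *
  generalize y⁻¹ ^ 4 = z at *
  generalize y⁻¹ ^ 5 = x at *
  generalize (l : ℝ) = a at *
  have hMu := mul_le_mul_of_nonneg_left hu hM
  have hMw := mul_le_mul_of_nonneg_left hv3 hM
  have hMu0 := mul_nonneg hM hu0.le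
  have hMw0 := mul_nonneg hM hw0.le
  rw [abs_le, abs_le]
  rcases hl with ⟨rfl, h⟩ | h | h
  · refine ⟨⟨?_, ?_⟩, ?_, ?_⟩ <;> nlinarith
  · have hau := mul_le_mul_of_nonneg_left hu (by linarith : 0 ≤ a)
    have haw := mul_le_mul_of_nonneg_left hv3 (by linarith : 0 ≤ a)
    have hau0 := mul_nonneg (by linarith : 0 ≤ a) hu0.le
    have haw0 := mul_nonneg (by linarith : 0 ≤ a) hw0.le
    refine ⟨⟨?_, ?_⟩, ?_, ?_⟩ <;> nlinarith
  · have hau := mul_le_mul_of_nonneg_left hu (by linarith : 0 ≤ -a - 1 / 2)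
    have haw := mul_le_mul_of_nonneg_left hv3 (by linarith : 0 ≤ -a - 1 / 2)
    have hau0 := mul_nonneg (by linarith : 0 ≤ -a - 1 / 2) hu0.le
    have haw0 := mul_nonneg (by linarith : 0 ≤ -a - 1 / 2) hw0.le
    refine ⟨⟨?_, ?_⟩, ?_, ?_⟩ <;> nlinarith
end

section
/- For every α > 0, the function y ↦ ∑_{k∈ℤ} exp(−παk²/y)·cos(2πk·(1/2 − 1/(8y²))) is strictly decreasing on [√3/2, ∞): for all √3/2 ≤ y₁ < y₂ the value at y₂ is strictly smaller than the value at y₁. -/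
/-- The heat-kernel-type sum `G_α(y) = ∑_{k∈ℤ} exp(−παk²/y)·cos(2πk(1/2 − 1/(8y²)))`. -/
noncomputable def Gheat (α y : ℝ) : ℝ :=
  ∑' k : ℤ, Real.exp (-Real.pi * α * (k : ℝ) ^ 2 / y) *
    Real.cos (2 * Real.pi * (k : ℝ) * (1 / 2 - 1 / (8 * y ^ 2)))

open HurwitzZeta in
theorem Gheat_eq_cosKernel {α y : ℝ} (hα : 0 < α) (hy : 0 < y) :
    Gheat α y = cosKernel ((1 / 2 - 1 / (8 * y ^ 2) : ℝ) : UnitAddCircle) (α / y) := by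
  have h := Complex.hasSum_re (hasSum_int_cosKernel (1 / 2 - 1 / (8 * y ^ 2)) (div_pos hα hy))
  rw [Complex.ofReal_re] at h
  rw [Gheat, ← h.tsum_eq]
  refine tsum_congr fun k => ?_
  rw [Complex.re_mul_ofReal, mul_comm]
  congr 1
  · have : 2 * (Real.pi : ℂ) * Complex.I * ((1 / 2 - 1 / (8 * y ^ 2) : ℝ) : ℂ) * (k : ℂ) =
        ((2 * Real.pi * (k : ℝ) * (1 / 2 - 1 / (8 * y ^ 2)) : ℝ) : ℂ) * Complex.I := by
      push_cast
      ring
    rw [this, Complex.exp_ofReal_mul_I_re]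
  · congr 1
    ring

theorem abs_sin_nat_mul_le (n : ℕ) (x : ℝ) : |Real.sin (n * x)| ≤ n * |Real.sin x| := by
  induction n with
  | zero => simp
  | succ n ih =>
    have h : ((n + 1 : ℕ) : ℝ) * x = n * x + x := by push_cast; ring
    rw [h, Real.sin_add]
    calc _ ≤ |Real.sin (n * x) * Real.cos x| + |Real.cos (n * x) * Real.sin x| := abs_add_le _ _
      _ ≤ |Real.sin (n * x)| + |Real.sin x| := by
        rw [abs_mul, abs_mul]
        exact add_le_add (mul_le_of_le_one_right (abs_nonneg _) (Real.abs_cos_le_one _))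
          (mul_le_of_le_one_left (abs_nonneg _) (Real.abs_cos_le_one _))
      _ ≤ _ := by push_cast; linarith

theorem abs_cos_nat_mul_sub_le (n : ℕ) (x y : ℝ) :
    |Real.cos (n * x) - Real.cos (n * y)| ≤ n ^ 2 * |Real.cos x - Real.cos y| := by
  have h₁ : ((n : ℝ) * x + n * y) / 2 = n * ((x + y) / 2) := by ring
  have h₂ : ((n : ℝ) * x - n * y) / 2 = n * ((x - y) / 2) := by ring
  rw [Real.cos_sub_cos, Real.cos_sub_cos, h₁, h₂]
  simp only [abs_mul]
  have h := mul_le_mul (abs_sin_nat_mul_le n ((x + y) / 2)) (abs_sin_nat_mul_le n ((x - y) / 2))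
    (abs_nonneg _) (by positivity)
  have h2 : |(-2 : ℝ)| = 2 := by norm_num
  rw [h2]
  linarith

theorem sq_mul_pow_le_geometric (n : ℕ) {q : ℝ} (hq₀ : 0 ≤ q) (hq : q ≤ 1 / 4) :
    ((n : ℝ) + 1) ^ 2 * q ^ ((n + 1) ^ 2 - 1) ≤ (1 / 16) ^ n := by
  have h₁ : 3 * n ≤ (n + 1) ^ 2 - 1 := by
    apply Nat.le_sub_of_add_le
    rcases n with _ | n
    · simp
    · nlinarith
  have h₂ : ((n : ℝ) + 1) ^ 2 ≤ 4 ^ n := by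
    have : ∀ m : ℕ, (m : ℝ) + 1 ≤ 2 ^ m := fun m => by exact_mod_cast Nat.lt_two_pow_self
    calc ((n : ℝ) + 1) ^ 2 ≤ (2 ^ n) ^ 2 := by gcongr; exact this n
      _ = 4 ^ n := by rw [← pow_mul, mul_comm, pow_mul]; norm_num
  calc ((n : ℝ) + 1) ^ 2 * q ^ ((n + 1) ^ 2 - 1) ≤ 4 ^ n * q ^ (3 * n) :=
        mul_le_mul h₂ (pow_le_pow_of_le_one hq₀ (by linarith) h₁) (by positivity) (by positivity)
    _ ≤ 4 ^ n * (1 / 4) ^ (3 * n) := by gcongr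
    _ = (1 / 16) ^ n := by rw [pow_mul, ← mul_pow]; norm_num

/-- A series whose tail is dominated by a small geometric series is bounded below by half of the
lower bound for its first term. -/
theorem half_le_of_hasSum {f : ℕ → ℝ} {S M : ℝ} (hf : HasSum f S) (hM : 0 ≤ M) (h₀ : M ≤ f 0)
    (h : ∀ n, |f (n + 1)| ≤ 2 * M * (1 / 16) ^ (n + 1)) : M / 2 ≤ S := by
  have hg : HasSum (fun n : ℕ => -(2 * M * (1 / 16) * (1 / 16) ^ n))
      (-(2 * M * (1 / 16) * (1 - 1 / 16)⁻¹)) :=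
    ((hasSum_geometric_of_lt_one (by norm_num) (by norm_num)).mul_left _).neg
  have hs : HasSum (fun n => f (n + 1)) (S - f 0) := by
    simpa using (hasSum_nat_add_iff' 1).mpr hf
  have := hasSum_le (fun n => ?_) hg hs
  · norm_num at this
    linarith
  · have := neg_le_of_abs_le (h n)
    rw [pow_succ] at this
    linarith

theorem exp_neg_pi_mul_le {a : ℝ} (ha : 1 / 2 ≤ a) : Real.exp (-Real.pi * a) ≤ 1 / 4 := by
  have h : 3 / 2 ≤ Real.pi * a := by nlinarith [Real.pi_gt_three]
  have h₁ : (2 : ℝ) ≤ Real.exp (3 / 4) := by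
    have := Real.quadratic_le_exp_of_nonneg (x := 3 / 4) (by norm_num)
    norm_num at this
    linarith
  have h₂ : (4 : ℝ) ≤ Real.exp (Real.pi * a) := by
    refine le_trans ?_ (Real.exp_le_exp.mpr h)
    have : (3 / 2 : ℝ) = 3 / 4 + 3 / 4 := by norm_num
    rw [this, Real.exp_add]
    nlinarith
  rw [neg_mul, Real.exp_neg, one_div]
  exact inv_anti₀ (by norm_num) h₂

theorem exp_neg_pi_sq_mul (n : ℕ) (a : ℝ) :
    Real.exp (-Real.pi * ((n : ℝ) + 1) ^ 2 * a) = Real.exp (-Real.pi * a) ^ ((n + 1) ^ 2) := by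
  rw [← Real.exp_nat_mul]
  congr 1
  push_cast
  ring

theorem cos_two_pi_mul_le {x : ℝ} (hx : x ∈ Set.Icc (1 / 3 : ℝ) (1 / 2)) :
    Real.cos (2 * Real.pi * x) ≤ -(1 / 2) := by
  have h : Real.cos (Real.pi - Real.pi / 3) = -(1 / 2) := by
    rw [Real.cos_pi_sub, Real.cos_pi_div_three]
  rw [← h]
  have := Real.pi_pos
  obtain ⟨h₁, h₂⟩ := hx
  exact Real.cos_le_cos_of_nonneg_of_le_pi (by nlinarith) (by nlinarith) (by nlinarith)

open HurwitzZeta in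
/-- For large time, the first Fourier mode governs the time derivative. -/
theorem cosKernel_strictMonoOn_time_Ici {x : ℝ} (hx : x ∈ Set.Icc (1 / 3 : ℝ) (1 / 2)) :
    StrictMonoOn (fun a => cosKernel x a) (Set.Ici (1 / 2)) := by
  intro a ha b hb hab
  rw [Set.mem_Ici] at ha hb
  have h := (hasSum_nat_cosKernel₀ x (by linarith : 0 < b)).sub
    (hasSum_nat_cosKernel₀ x (by linarith : 0 < a))
  simp only [exp_neg_pi_sq_mul] at h
  have hqa := exp_neg_pi_mul_le ha
  have hq : Real.exp (-Real.pi * b) < Real.exp (-Real.pi * a) :=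
    Real.exp_lt_exp.mpr (by nlinarith [Real.pi_pos])
  have hqb := Real.exp_pos (-Real.pi * b)
  set p := Real.exp (-Real.pi * b)
  set q := Real.exp (-Real.pi * a)
  have := half_le_of_hasSum h (sub_nonneg.mpr hq.le) ?_ fun n => ?_
  · change cosKernel x a < cosKernel x b
    linarith
  · have := cos_two_pi_mul_le hx
    norm_num
    nlinarith
  · rw [← mul_sub, abs_mul, abs_mul, abs_two, mul_assoc 2, mul_assoc 2 (q - p)]
    refine mul_le_mul_of_nonneg_left ?_ zero_le_two
    refine (mul_le_of_le_one_left (abs_nonneg _) (Real.abs_cos_le_one _)).trans ?_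
    refine (abs_pow_sub_pow_le p q _).trans ?_
    rw [abs_of_pos hqb, abs_of_pos (hqb.trans hq), max_eq_right hq.le, abs_sub_comm,
      abs_of_pos (sub_pos.mpr hq), mul_assoc]
    refine mul_le_mul_of_nonneg_left ?_ (sub_nonneg.mpr hq.le)
    exact_mod_cast sq_mul_pow_le_geometric (n + 1) (hqb.trans hq).le hqa

open HurwitzZeta in
/-- For large time, the first Fourier mode governs the space derivative. -/
theorem cosKernel_antitoneOn_space_of_half_le {a : ℝ} (ha : 1 / 2 ≤ a) :
    AntitoneOn (fun x : ℝ => cosKernel x a) (Set.Icc (1 / 3) (1 / 2)) := by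
  intro x hx y hy hxy
  have h := (hasSum_nat_cosKernel₀ x (by linarith : 0 < a)).sub
    (hasSum_nat_cosKernel₀ y (by linarith : 0 < a))
  simp only [exp_neg_pi_sq_mul] at h
  have hqa := exp_neg_pi_mul_le ha
  have hq := Real.exp_pos (-Real.pi * a)
  set q := Real.exp (-Real.pi * a)
  have hcos : 0 ≤ Real.cos (2 * Real.pi * x) - Real.cos (2 * Real.pi * y) := by
    have := Real.pi_pos
    refine sub_nonneg.mpr (Real.cos_le_cos_of_nonneg_of_le_pi ?_ ?_ ?_)
    · have := hx.1
      positivity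
    · nlinarith [hy.2]
    · nlinarith
  have := half_le_of_hasSum (M := 2 * (Real.cos (2 * Real.pi * x) - Real.cos (2 * Real.pi * y)) * q)
    h (by positivity) ?_ fun n => ?_
  · have h₀ : 0 ≤ 2 * (Real.cos (2 * Real.pi * x) - Real.cos (2 * Real.pi * y)) * q := by positivity
    change cosKernel y a ≤ cosKernel x a
    linarith
  · norm_num
    linarith
  · have hc := abs_cos_nat_mul_sub_le (n + 1 + 1) (2 * Real.pi * x) (2 * Real.pi * y)
    rw [abs_of_nonneg hcos] at hc
    have hg := sq_mul_pow_le_geometric (n + 1) hq.le hqa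
    have hpow : q ^ ((n + 1 + 1) ^ 2) = q ^ ((n + 1 + 1) ^ 2 - 1) * q := by
      rw [← pow_succ, Nat.sub_add_cancel (Nat.one_le_pow _ _ (Nat.succ_pos _))]
    rw [← sub_mul, ← mul_sub, abs_mul, abs_mul, abs_two, abs_of_pos (pow_pos hq _), hpow]
    rw [mul_comm (2 * Real.pi * x), mul_comm (2 * Real.pi * y)]
    push_cast at hc hg ⊢
    calc _ ≤ 2 * (((n : ℝ) + 1 + 1) ^ 2 *
          (Real.cos (2 * Real.pi * x) - Real.cos (2 * Real.pi * y))) *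
          (q ^ ((n + 1 + 1) ^ 2 - 1) * q) := by gcongr
      _ = 2 * (Real.cos (2 * Real.pi * x) - Real.cos (2 * Real.pi * y)) * q *
          (((n : ℝ) + 1 + 1) ^ 2 * q ^ ((n + 1 + 1) ^ 2 - 1)) := by ring
      _ ≤ 2 * (Real.cos (2 * Real.pi * x) - Real.cos (2 * Real.pi * y)) * q *
          (1 / 16) ^ (n + 1) := by gcongr
      _ ≤ _ := by
        have : 0 ≤ 2 * (Real.cos (2 * Real.pi * x) - Real.cos (2 * Real.pi * y)) * q *
          (1 / 16) ^ (n + 1) := by positivity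
        linarith

open HurwitzZeta in
theorem cosKernel_eq_sqrt_mul_evenKernel (x : UnitAddCircle) {a : ℝ} (ha : 0 < a) :
    cosKernel x a = √(1 / a) * evenKernel x (1 / a) := by
  have h : 0 < √(1 / a) := Real.sqrt_pos.mpr (by positivity)
  rw [evenKernel_functional_equation, ← Real.sqrt_eq_rpow, one_div_one_div]
  field_simp

theorem sqrt_mul_exp_neg_strictAntiOn {c : ℝ} (hc : 1 / 4 < c) :
    StrictAntiOn (fun s => √s * Real.exp (-c * s)) (Set.Ici 2) := by
  intro s hs t ht hst
  rw [Set.mem_Ici] at hs ht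
  have h : t ≤ s * Real.exp ((t - s) / 4) ^ 2 := by
    have h₁ := Real.add_one_le_exp ((t - s) / 2)
    rw [← Real.exp_nat_mul]
    have h₂ : ((2 : ℕ) : ℝ) * ((t - s) / 4) = (t - s) / 2 := by push_cast; ring
    rw [h₂]
    nlinarith
  have h' : √t ≤ √s * Real.exp ((t - s) / 4) := by
    rw [← Real.sqrt_sq (Real.exp_pos ((t - s) / 4)).le, ← Real.sqrt_mul (by linarith)]
    exact Real.sqrt_le_sqrt h
  calc √t * Real.exp (-c * t) ≤ √s * Real.exp ((t - s) / 4) * Real.exp (-c * t) := by gcongr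
    _ = √s * Real.exp ((t - s) / 4 - c * t) := by
      rw [mul_assoc, ← Real.exp_add, neg_mul, ← sub_eq_add_neg]
    _ < √s * Real.exp (-c * s) := by
      have : 0 < √s := Real.sqrt_pos.mpr (by linarith)
      gcongr
      nlinarith

theorem one_div_nine_le_int_add_sq (n : ℤ) {x : ℝ} (hx : x ∈ Set.Icc (1 / 3 : ℝ) (1 / 2)) :
    1 / 9 ≤ ((n : ℝ) + x) ^ 2 := by
  obtain ⟨h₁, h₂⟩ := hx
  rcases le_or_gt 0 n with hn | hn
  · have : (0 : ℝ) ≤ n := by exact_mod_cast hn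
    nlinarith
  · have : (n : ℝ) ≤ -1 := by exact_mod_cast Int.le_sub_one_of_lt hn
    nlinarith

open HurwitzZeta in
/-- For small time, every Gaussian in the periodisation increases with time. -/
theorem cosKernel_strictMonoOn_time_Ioc {x : ℝ} (hx : x ∈ Set.Icc (1 / 3 : ℝ) (1 / 2)) :
    StrictMonoOn (fun a => cosKernel x a) (Set.Ioc 0 (1 / 2)) := by
  intro a ha b hb hab
  have hb2 : 2 ≤ 1 / b := by rw [le_div_iff₀ hb.1]; linarith [hb.2]
  have hba : 1 / b < 1 / a := one_div_lt_one_div_of_lt ha.1 hab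
  have key (n : ℤ) : √(1 / a) * Real.exp (-Real.pi * (n + x) ^ 2 * (1 / a)) <
      √(1 / b) * Real.exp (-Real.pi * (n + x) ^ 2 * (1 / b)) := by
    rw [neg_mul]
    refine sqrt_mul_exp_neg_strictAntiOn ?_ hb2 (hb2.trans hba.le) hba
    nlinarith [Real.pi_gt_three, one_div_nine_le_int_add_sq n hx]
  change cosKernel x a < cosKernel x b
  rw [cosKernel_eq_sqrt_mul_evenKernel _ ha.1, cosKernel_eq_sqrt_mul_evenKernel _ hb.1]
  exact hasSum_lt (fun n => (key n).le) (key 0)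
    ((hasSum_int_evenKernel x (one_div_pos.mpr ha.1)).mul_left _)
    ((hasSum_int_evenKernel x (one_div_pos.mpr hb.1)).mul_left _)

theorem ConvexOn.add_le_add_of_mem_Icc {s : Set ℝ} {g : ℝ → ℝ} (hg : ConvexOn ℝ s g)
    {p q u v : ℝ} (hp : p ∈ s) (hq : q ∈ s) (hu : u ∈ Set.Icc p q) (huv : u + v = p + q) :
    g u + g v ≤ g p + g q := by
  obtain ⟨hpu, huq⟩ := hu
  rcases (hpu.trans huq).eq_or_lt with rfl | hpq
  · obtain rfl := le_antisymm huq hpu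
    obtain rfl : v = u := by linarith
    rfl
  · have hd : 0 < q - p := sub_pos.mpr hpq
    have h₀ : 0 ≤ (q - u) / (q - p) := div_nonneg (by linarith) hd.le
    have h₁ : 0 ≤ (u - p) / (q - p) := div_nonneg (by linarith) hd.le
    have hs : (q - u) / (q - p) + (u - p) / (q - p) = 1 := by field_simp; ring
    have hgu := hg.2 hp hq h₀ h₁ hs
    have hgv := hg.2 hp hq h₁ h₀ ((add_comm _ _).trans hs)
    have eu : ((q - u) / (q - p)) • p + ((u - p) / (q - p)) • q = u := by
      simp only [smul_eq_mul]; field_simp; ring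
    have ev : ((u - p) / (q - p)) • p + ((q - u) / (q - p)) • q = v := by
      obtain rfl : v = p + q - u := by linarith
      simp only [smul_eq_mul]; field_simp; ring
    rw [eu] at hgu
    rw [ev] at hgv
    simp only [smul_eq_mul] at hgu hgv
    calc g u + g v ≤ ((q - u) / (q - p) + (u - p) / (q - p)) * (g p + g q) := by linarith
      _ = g p + g q := by rw [hs, one_mul]

theorem convexOn_exp_neg_pi_sq_mul {s : ℝ} (hs : 2 ≤ s) :
    ConvexOn ℝ (Set.Ici (1 / 3)) fun w : ℝ => Real.exp (-Real.pi * w ^ 2 * s) := by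
  have h₁ (w : ℝ) : HasDerivAt (fun w : ℝ => Real.exp (-Real.pi * w ^ 2 * s))
      (-2 * Real.pi * s * (w * Real.exp (-Real.pi * w ^ 2 * s))) w := by
    convert ((((hasDerivAt_pow 2 w).const_mul (-Real.pi)).mul_const s).exp) using 1
    push_cast
    ring
  have h₂ (w : ℝ) : HasDerivAt
      (fun w : ℝ => -2 * Real.pi * s * (w * Real.exp (-Real.pi * w ^ 2 * s)))
      (2 * Real.pi * s * (2 * Real.pi * s * w ^ 2 - 1) * Real.exp (-Real.pi * w ^ 2 * s)) w := by
    refine (((hasDerivAt_id w).mul (h₁ w)).const_mul (-2 * Real.pi * s)).congr_deriv ?_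
    simp only [id]
    ring
  refine convexOn_of_hasDerivWithinAt2_nonneg (convex_Ici _)
    (fun w _ => (h₁ w).continuousAt.continuousWithinAt) (fun w _ => (h₁ w).hasDerivWithinAt)
    (fun w _ => (h₂ w).hasDerivWithinAt) fun w hw => ?_
  rw [interior_Ici, Set.mem_Ioi] at hw
  have hπ := Real.pi_gt_three
  have h₃ : 6 ≤ Real.pi * s := by nlinarith
  have h₄ : 0 ≤ 2 * Real.pi * s * w ^ 2 - 1 := by nlinarith
  positivity

open HurwitzZeta in
/-- For small time, convexity of the Gaussians gives monotonicity in space. -/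
theorem cosKernel_antitoneOn_space_of_le_half {a : ℝ} (ha₀ : 0 < a) (ha : a ≤ 1 / 2) :
    AntitoneOn (fun x : ℝ => cosKernel x a) (Set.Icc (1 / 3) (1 / 2)) := by
  intro x hx y hy hxy
  have hs : 2 ≤ 1 / a := by rw [le_div_iff₀ ha₀]; linarith
  change cosKernel y a ≤ cosKernel x a
  rw [cosKernel_eq_sqrt_mul_evenKernel _ ha₀, cosKernel_eq_sqrt_mul_evenKernel _ ha₀]
  refine mul_le_mul_of_nonneg_left ?_ (Real.sqrt_nonneg _)
  refine hasSum_le (fun n => ?_)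
    (hasSum_int_evenKernel y (one_div_pos.mpr ha₀)).nat_add_neg_add_one
    (hasSum_int_evenKernel x (one_div_pos.mpr ha₀)).nat_add_neg_add_one
  have hn : (0 : ℝ) ≤ n := n.cast_nonneg
  have hsq (z : ℝ) : (((-((n : ℤ) + 1) : ℤ) : ℝ) + z) ^ 2 = (n + 1 - z) ^ 2 := by
    push_cast
    ring
  simp only [hsq, Int.cast_natCast]
  obtain ⟨hx₁, hx₂⟩ := hx
  obtain ⟨hy₁, hy₂⟩ := hy
  refine (convexOn_exp_neg_pi_sq_mul hs).add_le_add_of_mem_Icc ?_ ?_ ⟨?_, ?_⟩ ?_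
  · rw [Set.mem_Ici]; linarith
  · rw [Set.mem_Ici]; linarith
  all_goals linarith

/-- For every `α > 0`, the function `y ↦ G_α(y)` is strictly decreasing on `[√3/2, ∞)`. -/
theorem Gheat_strictAnti (α : ℝ) (hα : 0 < α) :
    StrictAntiOn (Gheat α) (Set.Ici (Real.sqrt 3 / 2)) := by
  have hpos {y : ℝ} (hy : y ∈ Set.Ici (√3 / 2)) : 0 < y :=
    lt_of_lt_of_le (by positivity) (Set.mem_Ici.mp hy)
  have hmem {y : ℝ} (hy : y ∈ Set.Ici (√3 / 2)) :
      1 / 2 - 1 / (8 * y ^ 2) ∈ Set.Icc (1 / 3 : ℝ) (1 / 2) := by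
    have h₀ := hpos hy
    have h₁ : 3 / 4 ≤ y ^ 2 := by
      have := pow_le_pow_left₀ (by positivity) (Set.mem_Ici.mp hy) 2
      rw [div_pow, Real.sq_sqrt (by norm_num)] at this
      linarith
    have h₂ : 1 / (8 * y ^ 2) ≤ 1 / 6 := one_div_le_one_div_of_le (by norm_num) (by linarith)
    have h₃ : 0 < 1 / (8 * y ^ 2) := by positivity
    constructor <;> linarith
  intro y hy z hz hyz
  have hy₀ := hpos hy
  have hz₀ := hpos hz
  have hdiv : α / z < α / y := div_lt_div_of_pos_left hα hy₀ hyz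
  have hle : 1 / 2 - 1 / (8 * y ^ 2) ≤ 1 / 2 - 1 / (8 * z ^ 2) := by gcongr
  rw [Gheat_eq_cosKernel hα hy₀, Gheat_eq_cosKernel hα hz₀]
  have htime := (cosKernel_strictMonoOn_time_Ioc (hmem hy)).union
    (cosKernel_strictMonoOn_time_Ici (hmem hy)) (isGreatest_Ioc (by norm_num)) isLeast_Ici
  rw [Set.Ioc_union_Ici_eq_Ioi (by norm_num)] at htime
  refine lt_of_le_of_lt ?_ (htime (div_pos hα hz₀) (div_pos hα hy₀) hdiv)
  rcases le_total (α / z) (1 / 2) with h | h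
  · exact cosKernel_antitoneOn_space_of_le_half (div_pos hα hz₀) h (hmem hy) (hmem hz) hle
  · exact cosKernel_antitoneOn_space_of_half_le h (hmem hy) (hmem hz) hle
end
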